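/- For every positive integer m, ∑_{r∈ℤ, r odd} H(4m−r²) = (2/3)·σ₁(m) + 2·σ₁(m/2) − (8/3)·σ₁(m/4) − (1/2)·∑_{a,b∈ℤ, b²+b−a²−a=m} min(|a+b+1|, |a−b|), where both sums have only finitely many nonzero terms. -/

import Mathlib

/-!
STATEMENT 8: For every positive integer m,
∑_{r∈ℤ, r odd} H(4m−r²) = (2/3)σ₁(m) + 2σ₁(m/2) − (8/3)σ₁(m/4)
  − (1/2)·∑_{a,b∈ℤ, b²+b−a²−a=m} min(|a+b+1|,|a−b|),
where σ₁(t)=0 if t is not a positive integer, and both sums have only finitely many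
nonzero terms.
-/

/-- Integral binary quadratic forms [a,b,c] are represented as triples (a,b,c) ∈ ℤ³,
with Q(x,y) = ax² + bxy + cy² and discriminant b² − 4ac. -/
def qfAct (g : Matrix.SpecialLinearGroup (Fin 2) ℤ) (Q : ℤ × ℤ × ℤ) : ℤ × ℤ × ℤ :=
  ((Q.1 * (g.1 0 0) ^ 2 + Q.2.1 * (g.1 0 0) * (g.1 0 1) + Q.2.2 * (g.1 0 1) ^ 2),
   (2 * Q.1 * (g.1 0 0) * (g.1 1 0) + Q.2.1 * ((g.1 0 0) * (g.1 1 1) + (g.1 0 1) * (g.1 1 0)) +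
      2 * Q.2.2 * (g.1 0 1) * (g.1 1 1)),
   (Q.1 * (g.1 1 0) ^ 2 + Q.2.1 * (g.1 1 0) * (g.1 1 1) + Q.2.2 * (g.1 1 1) ^ 2))

/-- SL₂(ℤ)-equivalence of integral binary quadratic forms. -/
def qfRel (Q₁ Q₂ : ℤ × ℤ × ℤ) : Prop := ∃ g : Matrix.SpecialLinearGroup (Fin 2) ℤ, qfAct g Q₁ = Q₂

/-- The set of SL₂(ℤ)-classes of positive definite integral binary quadratic forms of
discriminant −n. -/
def qfClasses (n : ℤ) : Set (Quot qfRel) :=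
  {q | ∃ Q : ℤ × ℤ × ℤ, Quot.mk qfRel Q = q ∧ Q.2.1 ^ 2 - 4 * Q.1 * Q.2.2 = -n ∧ 0 < Q.1}

/-- The Hurwitz class number H(n): H(0) = −1/12; for n > 0 with n ≡ 0, 3 (mod 4), H(n) is the
number of SL₂(ℤ)-classes of positive definite integral binary quadratic forms of discriminant
−n, where the class containing a multiple of x²+y² is counted with weight 1/2 and the class
containing a multiple of x²+xy+y² with weight 1/3; H(n) = 0 otherwise. -/
noncomputable def hurwitzH (n : ℤ) : ℝ :=
  if n = 0 then -(1 / 12)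
  else if 0 < n ∧ (n % 4 = 0 ∨ n % 4 = 3) then
    ((qfClasses n).ncard : ℝ)
      - 1 / 2 * (({q ∈ qfClasses n | ∃ k : ℤ, Quot.mk qfRel (k, 0, k) = q}).ncard : ℝ)
      - 2 / 3 * (({q ∈ qfClasses n | ∃ k : ℤ, Quot.mk qfRel (k, k, k) = q}).ncard : ℝ)
  else 0

/-- σ₁ extended to ℚ: σ₁(t) = ∑_{d∣t} d if t is a positive integer, and 0 otherwise. -/
noncomputable def sigma1Q (t : ℚ) : ℝ :=
  if t.den = 1 ∧ 0 < t.num then ∑ d ∈ t.num.toNat.divisors, (d : ℝ) else 0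

/-- Quadruples of positive integers with `a * b + c * e = m`. -/
noncomputable def quads (m : ℤ) : Finset (ℤ × ℤ × ℤ × ℤ) :=
  (Finset.Icc 1 m ×ˢ Finset.Icc 1 m ×ˢ Finset.Icc 1 m ×ˢ Finset.Icc 1 m).filter
    fun x => x.1 * x.2.1 + x.2.2.1 * x.2.2.2 = m

theorem mem_quads {m : ℤ} {x : ℤ × ℤ × ℤ × ℤ} :
    x ∈ quads m ↔ 0 < x.1 ∧ 0 < x.2.1 ∧ 0 < x.2.2.1 ∧ 0 < x.2.2.2 ∧
      x.1 * x.2.1 + x.2.2.1 * x.2.2.2 = m := by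
  obtain ⟨a, b, c, e⟩ := x
  simp only [quads, Finset.mem_filter, Finset.mem_product, Finset.mem_Icc]
  constructor
  · rintro ⟨⟨⟨ha, -⟩, ⟨hb, -⟩, ⟨hc, -⟩, he, -⟩, h⟩
    exact ⟨ha, hb, hc, he, h⟩
  · rintro ⟨ha, hb, hc, he, h⟩
    have h1 : 0 < a * b := mul_pos ha hb
    have h2 : 0 < c * e := mul_pos hc he
    refine ⟨⟨⟨ha, ?_⟩, ⟨hb, ?_⟩, ⟨hc, ?_⟩, he, ?_⟩, h⟩ <;> nlinarith

open Classical in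
/-- The number of positive quadruples `(a, b, c, e)` with `a * b + c * e = m` satisfying `P`. -/
noncomputable def quadCount (m : ℤ) (P : ℤ → ℤ → ℤ → ℤ → Prop) : ℕ :=
  ((quads m).filter fun x => P x.1 x.2.1 x.2.2.1 x.2.2.2).card

open Classical in
theorem quadCount_eq_sum (m : ℤ) (P : ℤ → ℤ → ℤ → ℤ → Prop) :
    quadCount m P = ∑ x ∈ quads m, if P x.1 x.2.1 x.2.2.1 x.2.2.2 then 1 else 0 := by
  rw [quadCount, Finset.card_filter]

theorem quadCount_bij (m : ℤ) {P P' : ℤ → ℤ → ℤ → ℤ → Prop}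
    (f g : ℤ → ℤ → ℤ → ℤ → ℤ × ℤ × ℤ × ℤ)
    (hf : ∀ a b c e, (f a b c e).1 * (f a b c e).2.1 + (f a b c e).2.2.1 * (f a b c e).2.2.2
      = a * b + c * e)
    (hgf : ∀ a b c e, g (f a b c e).1 (f a b c e).2.1 (f a b c e).2.2.1 (f a b c e).2.2.2
      = (a, b, c, e))
    (hfg : ∀ a b c e, f (g a b c e).1 (g a b c e).2.1 (g a b c e).2.2.1 (g a b c e).2.2.2
      = (a, b, c, e))
    (hP : ∀ a b c e, 0 < a → 0 < b → 0 < c → 0 < e → P a b c e →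
      0 < (f a b c e).1 ∧ 0 < (f a b c e).2.1 ∧ 0 < (f a b c e).2.2.1 ∧ 0 < (f a b c e).2.2.2 ∧
      P' (f a b c e).1 (f a b c e).2.1 (f a b c e).2.2.1 (f a b c e).2.2.2)
    (hP' : ∀ a b c e, 0 < a → 0 < b → 0 < c → 0 < e → P' a b c e →
      0 < (g a b c e).1 ∧ 0 < (g a b c e).2.1 ∧ 0 < (g a b c e).2.2.1 ∧ 0 < (g a b c e).2.2.2 ∧
      P (g a b c e).1 (g a b c e).2.1 (g a b c e).2.2.1 (g a b c e).2.2.2) :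
    quadCount m P = quadCount m P' := by
  classical
  refine Finset.card_bij' (fun x _ => f x.1 x.2.1 x.2.2.1 x.2.2.2)
    (fun x _ => g x.1 x.2.1 x.2.2.1 x.2.2.2) ?_ ?_ ?_ ?_
  · rintro ⟨a, b, c, e⟩ h
    simp only [Finset.mem_filter, mem_quads] at h ⊢
    obtain ⟨⟨ha, hb, hc, he, hm⟩, h⟩ := h
    obtain ⟨h1, h2, h3, h4, h5⟩ := hP a b c e ha hb hc he h
    exact ⟨⟨h1, h2, h3, h4, by rw [hf, hm]⟩, h5⟩
  · rintro ⟨a, b, c, e⟩ h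
    simp only [Finset.mem_filter, mem_quads] at h ⊢
    obtain ⟨⟨ha, hb, hc, he, hm⟩, h⟩ := h
    obtain ⟨h1, h2, h3, h4, h5⟩ := hP' a b c e ha hb hc he h
    refine ⟨⟨h1, h2, h3, h4, ?_⟩, h5⟩
    rw [← hf, hfg, hm]
  · rintro ⟨a, b, c, e⟩ -
    exact hgf a b c e
  · rintro ⟨a, b, c, e⟩ -
    exact hfg a b c e

theorem quadCount_congr {m : ℤ} {P P' : ℤ → ℤ → ℤ → ℤ → Prop}
    (h : ∀ a b c e, 0 < a → 0 < b → 0 < c → 0 < e → (P a b c e ↔ P' a b c e)) :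
    quadCount m P = quadCount m P' := by
  classical
  refine congrArg Finset.card (Finset.filter_congr fun x hx => ?_)
  rw [mem_quads] at hx
  exact h _ _ _ _ hx.1 hx.2.1 hx.2.2.1 hx.2.2.2.1

/-- Quadruples coming from solutions of `4m = r² + uv + vw + wu` in odd positive integers
with `w < r`. -/
theorem quadCount_small_w (m : ℤ) :
    quadCount m (fun a b c e => (c + e) % 2 = 1 ∧ e < c ∧ c - e < 2 * a ∧ c - e < 2 * b)
      + quadCount m (fun a b c e => (c + e) % 2 = 1 ∧ c - e = a + b ∧ a < b)
    = quadCount m (fun a _ c e => (c + e) % 2 = 1 ∧ a = e ∧ e < c)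
      + quadCount m (fun a _ c e => (c + e) % 2 = 1 ∧ a = 2 * e ∧ e < c) := by
  have h1 : quadCount m (fun _ b c e => (c + e) % 2 = 1 ∧ 2 * b < c - e)
      = quadCount m (fun a _ c e => (c + e) % 2 = 1 ∧ e < c ∧ 2 * e < a) := by
    refine quadCount_bij m (fun a b c e => (a + 2 * e, b, c - 2 * b, e))
      (fun a b c e => (a - 2 * e, b, c + 2 * b, e)) ?_ ?_ ?_ ?_ ?_
    · intros; ring
    · intros; simp
    · intros; simp
    · intros; dsimp only; omega
    · intros; dsimp only; omega
  have h2 : quadCount m (fun a b c e => (c + e) % 2 = 1 ∧ 2 * a < c - e ∧ c - e < a + b)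
      = quadCount m (fun a _ c e => (c + e) % 2 = 1 ∧ e < c ∧ a < e) := by
    refine quadCount_bij m (fun a b c e => (a, b + a - c + e, c - a, a + e))
      (fun a b c e => (a, a + b + c - e, c + a, e - a)) ?_ ?_ ?_ ?_ ?_
    · intros; ring
    · intros; ext <;> dsimp only <;> ring
    · intros; ext <;> dsimp only <;> ring
    · intros; dsimp only; omega
    · intros; dsimp only; omega
  have h3 : quadCount m (fun a b c e => (c + e) % 2 = 1 ∧ a + b < c - e ∧ c - e < 2 * b)
      = quadCount m (fun a _ c e => (c + e) % 2 = 1 ∧ e < c ∧ e < a ∧ a < 2 * e) := by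
    refine quadCount_bij m (fun a b c e => (a + 2 * e, c - e - a - b, a + 2 * b + 2 * e - c, a + e))
      (fun a b c e => (2 * e - a, e - a + b + c, 2 * e - a + 2 * b + c, a - e)) ?_ ?_ ?_ ?_ ?_
    · intros; ring
    · intros; ext <;> dsimp only <;> ring
    · intros; ext <;> dsimp only <;> ring
    · intros; dsimp only; omega
    · intros; dsimp only; omega
  have key : quadCount m (fun a b c e => (c + e) % 2 = 1 ∧ e < c ∧ c - e < 2 * a ∧ c - e < 2 * b)
      + quadCount m (fun a b c e => (c + e) % 2 = 1 ∧ c - e = a + b ∧ a < b)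
      + quadCount m (fun _ b c e => (c + e) % 2 = 1 ∧ 2 * b < c - e)
      + quadCount m (fun a b c e => (c + e) % 2 = 1 ∧ 2 * a < c - e ∧ c - e < a + b)
      + quadCount m (fun a b c e => (c + e) % 2 = 1 ∧ a + b < c - e ∧ c - e < 2 * b)
      = quadCount m (fun a _ c e => (c + e) % 2 = 1 ∧ a = e ∧ e < c)
      + quadCount m (fun a _ c e => (c + e) % 2 = 1 ∧ a = 2 * e ∧ e < c)
      + quadCount m (fun a _ c e => (c + e) % 2 = 1 ∧ e < c ∧ 2 * e < a)
      + quadCount m (fun a _ c e => (c + e) % 2 = 1 ∧ e < c ∧ a < e)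
      + quadCount m (fun a _ c e => (c + e) % 2 = 1 ∧ e < c ∧ e < a ∧ a < 2 * e) := by
    classical
    simp only [quadCount_eq_sum, ← Finset.sum_add_distrib]
    refine Finset.sum_congr rfl fun x hx => ?_
    rw [mem_quads] at hx
    obtain ⟨a, b, c, e⟩ := x
    obtain ⟨ha, hb, hc, he, -⟩ := hx
    dsimp only at *
    by_cases h1 : (c + e) % 2 = 1 ∧ e < c
    · have h5 : (c + e) % 2 = 1 := h1.1
      have h6 : e < c := h1.2
      simp only [h5, h6, true_and, and_true]
      trans 1
      · split_ifs <;> omega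
      · split_ifs <;> omega
    · rw [if_neg (by omega), if_neg (by omega), if_neg (by omega), if_neg (by omega),
        if_neg (by omega), if_neg (by omega), if_neg (by omega), if_neg (by omega),
        if_neg (by omega), if_neg (by omega)]
  omega

theorem quadCount_add {m : ℤ} {P Q R : ℤ → ℤ → ℤ → ℤ → Prop}
    (h : ∀ a b c e, 0 < a → 0 < b → 0 < c → 0 < e →
      (P a b c e ↔ Q a b c e ∨ R a b c e) ∧ ¬ (Q a b c e ∧ R a b c e)) :
    quadCount m P = quadCount m Q + quadCount m R := by
  classical
  simp only [quadCount_eq_sum, ← Finset.sum_add_distrib]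
  refine Finset.sum_congr rfl fun x hx => ?_
  rw [mem_quads] at hx
  have := h _ _ _ _ hx.1 hx.2.1 hx.2.2.1 hx.2.2.2.1
  split_ifs <;> first | rfl | tauto

theorem quadCount_swap_ab {m : ℤ} (P : ℤ → ℤ → ℤ → ℤ → Prop) :
    quadCount m P = quadCount m (fun a b c e => P b a c e) := by
  refine quadCount_bij m (fun a b c e => (b, a, c, e)) (fun a b c e => (b, a, c, e)) ?_ ?_ ?_ ?_ ?_
  · intros; ring
  · intros; rfl
  · intros; rfl
  · intros; simp_all
  · intros; simp_all

theorem quadCount_swap_ce {m : ℤ} (P : ℤ → ℤ → ℤ → ℤ → Prop) :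
    quadCount m P = quadCount m (fun a b c e => P a b e c) := by
  refine quadCount_bij m (fun a b c e => (a, b, e, c)) (fun a b c e => (a, b, e, c)) ?_ ?_ ?_ ?_ ?_
  · intros; ring
  · intros; rfl
  · intros; rfl
  · intros; simp_all
  · intros; simp_all

/-- Quadruples whose entries `a`, `b`, `e` form the sides of a triangle of odd perimeter, with
`e` the strictly longest side. -/
theorem quadCount_triangle_e (m : ℤ) :
    2 * quadCount m (fun a b _ e => (a + b + e) % 2 = 1 ∧ a < e ∧ b < e ∧ e < a + b)
      + quadCount m (fun a b c e => (a + b + e) % 2 = 1 ∧ a + b < e ∧ e - a - b = c)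
      + quadCount m (fun a b _ e => (a + b + e) % 2 = 1 ∧ b < e ∧ e < a)
    = quadCount m (fun a b _ e => (a + b + e) % 2 = 1 ∧ a < e ∧ b < e) := by
  have h1 : quadCount m (fun a b _ e => (a + b + e) % 2 = 1 ∧ a < e ∧ b < e ∧ e < a + b)
      = quadCount m (fun a b c e => (a + b + e) % 2 = 1 ∧ a + b < e ∧ e - a - b < c) := by
    refine quadCount_bij m (fun a b c e => (e - a, e - b, c + a + b - e, e))
      (fun a b c e => (e - a, e - b, c - e + a + b, e)) ?_ ?_ ?_ ?_ ?_
    · intros; ring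
    · intros; ext <;> dsimp only <;> ring
    · intros; ext <;> dsimp only <;> ring
    · intros; dsimp only; omega
    · intros; dsimp only; omega
  have h2 : quadCount m (fun a b c e => (a + b + e) % 2 = 1 ∧ a + b < e ∧ c < e - a - b)
      = quadCount m (fun a b c e => (c + e) % 2 = 1 ∧ e < a ∧ e < b) := by
    refine quadCount_bij m (fun a b c e => (a + c, b + c, e - a - b - c, c))
      (fun a b c e => (a - e, b - e, e, a + b + c - e)) ?_ ?_ ?_ ?_ ?_
    · intros; ring
    · intros; ext <;> dsimp only <;> ring
    · intros; ext <;> dsimp only <;> ring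
    · intros; dsimp only; omega
    · intros; dsimp only; omega
  have h3 : quadCount m (fun a b _ e => (a + b + e) % 2 = 1 ∧ b < e ∧ e < a)
      = quadCount m (fun a b c e => (c + e) % 2 = 1 ∧ e < a ∧ e < b) := by
    refine quadCount_bij m (fun a b c e => (b + c, e, a - e, b))
      (fun a b c e => (c + b, e, a - e, b)) ?_ ?_ ?_ ?_ ?_
    · intros; ring
    · intros; ext <;> dsimp only <;> ring
    · intros; ext <;> dsimp only <;> ring
    · intros; dsimp only; omega
    · intros; dsimp only; omega
  have h4 : quadCount m (fun a b _ e => (a + b + e) % 2 = 1 ∧ a < e ∧ b < e)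
      = quadCount m (fun a b _ e => (a + b + e) % 2 = 1 ∧ a < e ∧ b < e ∧ e < a + b)
      + quadCount m (fun a b _ e => (a + b + e) % 2 = 1 ∧ a + b < e) :=
    quadCount_add (by intros; omega)
  have h5 : quadCount m (fun a b _ e => (a + b + e) % 2 = 1 ∧ a + b < e)
      = quadCount m (fun a b c e => (a + b + e) % 2 = 1 ∧ a + b < e ∧ e - a - b < c)
      + quadCount m (fun a b c e => (a + b + e) % 2 = 1 ∧ a + b < e ∧ c ≤ e - a - b) :=
    quadCount_add (by intros; omega)
  have h6 : quadCount m (fun a b c e => (a + b + e) % 2 = 1 ∧ a + b < e ∧ c ≤ e - a - b)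
      = quadCount m (fun a b c e => (a + b + e) % 2 = 1 ∧ a + b < e ∧ e - a - b = c)
      + quadCount m (fun a b c e => (a + b + e) % 2 = 1 ∧ a + b < e ∧ c < e - a - b) :=
    quadCount_add (by intros; omega)
  omega

/-- Quadruples with `a > b + e` and `a + b + e` odd. -/
theorem quadCount_long_a (m : ℤ) :
    4 * quadCount m (fun a b _ e => (a + b + e) % 2 = 1 ∧ b + e < a)
      + 2 * quadCount m (fun a _ c e => (c + e) % 2 = 1 ∧ a = e ∧ e < c)
      + quadCount m (fun a b c e => (a + b + e) % 2 = 1 ∧ a = c ∧ a < e)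
    = 2 * quadCount m (fun a b _ e => (a + b + e) % 2 = 1 ∧ e < a)
      + quadCount m (fun a b _ e => (a + b + e) % 2 = 1 ∧ a < e)
      + 2 * quadCount m (fun a _ c e => (c + e) % 2 = 1 ∧ a = e ∧ c < e)
      + 2 * quadCount m (fun a b c e => (a + b + e) % 2 = 1 ∧ a = e ∧ a < c) := by
  have h1 : quadCount m (fun a b _ e => (a + b + e) % 2 = 1 ∧ b + e < a)
      = quadCount m (fun a _ c e => (c + e) % 2 = 1 ∧ e < c ∧ e < a) := by
    refine quadCount_bij m (fun a b c e => (b + c, e, a - e, b))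
      (fun a b c e => (c + b, e, a - e, b)) ?_ ?_ ?_ ?_ ?_
    · intros; ring
    · intros; ext <;> dsimp only <;> ring
    · intros; ext <;> dsimp only <;> ring
    · intros; dsimp only; omega
    · intros; dsimp only; omega
  have h2 : quadCount m (fun a b _ e => (a + b + e) % 2 = 1 ∧ e < a)
      = quadCount m (fun a _ c e => (c + e) % 2 = 1 ∧ e < a) := by
    refine quadCount_bij m (fun a b c e => (b + c, e, a - e, b))
      (fun a b c e => (c + b, e, a - e, b)) ?_ ?_ ?_ ?_ ?_
    · intros; ring
    · intros; ext <;> dsimp only <;> ring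
    · intros; ext <;> dsimp only <;> ring
    · intros; dsimp only; omega
    · intros; dsimp only; omega
  have h3 : quadCount m (fun a _ c e => (c + e) % 2 = 1 ∧ a < c ∧ a < e)
      = quadCount m (fun a b c e => (a + b + e) % 2 = 1 ∧ a < c ∧ e < a) := by
    refine quadCount_bij m (fun a b c e => (e, c - a, b + e, a))
      (fun a b c e => (e, c - a, b + e, a)) ?_ ?_ ?_ ?_ ?_
    · intros; ring
    · intros; ext <;> dsimp only <;> ring
    · intros; ext <;> dsimp only <;> ring
    · intros; dsimp only; omega
    · intros; dsimp only; omega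
  have h4 : quadCount m (fun a _ c e => (c + e) % 2 = 1 ∧ a < e)
      = quadCount m (fun a b c e => (a + b + e) % 2 = 1 ∧ a < c) := by
    refine quadCount_bij m (fun a b c e => (c, e - a, b + c, a))
      (fun a b c e => (e, c - a, a, b + e)) ?_ ?_ ?_ ?_ ?_
    · intros; ring
    · intros; ext <;> dsimp only <;> ring
    · intros; ext <;> dsimp only <;> ring
    · intros; dsimp only; omega
    · intros; dsimp only; omega
  have h5 : quadCount m (fun a b c e => (a + b + e) % 2 = 1 ∧ a < c ∧ a < e)
      = quadCount m (fun a b c e => (a + b + e) % 2 = 1 ∧ a < e ∧ c < a) := by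
    refine quadCount_bij m (fun a b c e => (c, e - a, a, b + c))
      (fun a b c e => (c, e - a, a, b + c)) ?_ ?_ ?_ ?_ ?_
    · intros; ring
    · intros; ext <;> dsimp only <;> ring
    · intros; ext <;> dsimp only <;> ring
    · intros; dsimp only; omega
    · intros; dsimp only; omega
  have s1 : quadCount m (fun a _ c e => (c + e) % 2 = 1 ∧ e < c ∧ e < a)
      = quadCount m (fun a _ c e => (c + e) % 2 = 1 ∧ c < e ∧ c < a) := by
    rw [quadCount_swap_ce]; exact quadCount_congr (by intros; omega)
  have s2 : quadCount m (fun a _ c e => (c + e) % 2 = 1 ∧ a = e ∧ e < c)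
      = quadCount m (fun a _ c e => (c + e) % 2 = 1 ∧ a = c ∧ c < e) := by
    rw [quadCount_swap_ce]; exact quadCount_congr (by intros; omega)
  have d1 : quadCount m (fun _ _ c e => (c + e) % 2 = 1)
      = quadCount m (fun a _ c e => (c + e) % 2 = 1 ∧ a < c ∧ a < e)
      + quadCount m (fun a _ c e => (c + e) % 2 = 1 ∧ ¬ (a < c ∧ a < e)) :=
    quadCount_add (by intros; omega)
  have d2 : quadCount m (fun a _ c e => (c + e) % 2 = 1 ∧ ¬ (a < c ∧ a < e))
      = quadCount m (fun a _ c e => (c + e) % 2 = 1 ∧ e < c ∧ e ≤ a)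
      + quadCount m (fun a _ c e => (c + e) % 2 = 1 ∧ c < e ∧ c ≤ a) :=
    quadCount_add (by intros; omega)
  have d3 : quadCount m (fun a _ c e => (c + e) % 2 = 1 ∧ e < c ∧ e ≤ a)
      = quadCount m (fun a _ c e => (c + e) % 2 = 1 ∧ e < c ∧ e < a)
      + quadCount m (fun a _ c e => (c + e) % 2 = 1 ∧ a = e ∧ e < c) :=
    quadCount_add (by intros; omega)
  have d4 : quadCount m (fun a _ c e => (c + e) % 2 = 1 ∧ c < e ∧ c ≤ a)
      = quadCount m (fun a _ c e => (c + e) % 2 = 1 ∧ c < e ∧ c < a)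
      + quadCount m (fun a _ c e => (c + e) % 2 = 1 ∧ a = c ∧ c < e) :=
    quadCount_add (by intros; omega)
  have d5 : quadCount m (fun _ _ c e => (c + e) % 2 = 1)
      = quadCount m (fun a _ c e => (c + e) % 2 = 1 ∧ e < a)
      + quadCount m (fun a _ c e => (c + e) % 2 = 1 ∧ a ≤ e) :=
    quadCount_add (by intros; omega)
  have d6 : quadCount m (fun a _ c e => (c + e) % 2 = 1 ∧ a ≤ e)
      = quadCount m (fun a _ c e => (c + e) % 2 = 1 ∧ a < e)
      + quadCount m (fun a _ c e => (c + e) % 2 = 1 ∧ a = e) :=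
    quadCount_add (by intros; omega)
  have d7 : quadCount m (fun a _ c e => (c + e) % 2 = 1 ∧ a = e)
      = quadCount m (fun a _ c e => (c + e) % 2 = 1 ∧ a = e ∧ c < e)
      + quadCount m (fun a _ c e => (c + e) % 2 = 1 ∧ a = e ∧ e < c) :=
    quadCount_add (by intros; omega)
  have d8 : quadCount m (fun a b c e => (a + b + e) % 2 = 1 ∧ a < c)
      = quadCount m (fun a b c e => (a + b + e) % 2 = 1 ∧ a < c ∧ e < a)
      + quadCount m (fun a b c e => (a + b + e) % 2 = 1 ∧ a < c ∧ a ≤ e) :=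
    quadCount_add (by intros; omega)
  have d9 : quadCount m (fun a b c e => (a + b + e) % 2 = 1 ∧ a < c ∧ a ≤ e)
      = quadCount m (fun a b c e => (a + b + e) % 2 = 1 ∧ a < c ∧ a < e)
      + quadCount m (fun a b c e => (a + b + e) % 2 = 1 ∧ a = e ∧ a < c) :=
    quadCount_add (by intros; omega)
  have d10 : quadCount m (fun a b _ e => (a + b + e) % 2 = 1 ∧ a < e)
      = quadCount m (fun a b c e => (a + b + e) % 2 = 1 ∧ a < e ∧ c < a)
      + quadCount m (fun a b c e => (a + b + e) % 2 = 1 ∧ a < e ∧ a ≤ c) :=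
    quadCount_add (by intros; omega)
  have d11 : quadCount m (fun a b c e => (a + b + e) % 2 = 1 ∧ a < e ∧ a ≤ c)
      = quadCount m (fun a b c e => (a + b + e) % 2 = 1 ∧ a < c ∧ a < e)
      + quadCount m (fun a b c e => (a + b + e) % 2 = 1 ∧ a = c ∧ a < e) :=
    quadCount_add (by intros; omega)
  omega

theorem quadCount_triangle (m : ℤ) :
    quadCount m
      (fun a b _ e => (a + b + e) % 2 = 1 ∧ a - b < e ∧ b - a < e ∧ e < a + b)
    + quadCount m (fun a b _ e => (a + b + e) % 2 = 1 ∧ b + e < a)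
    + quadCount m (fun a b _ e => (a + b + e) % 2 = 1 ∧ a + e < b)
    = quadCount m (fun a b _ e => (a + b + e) % 2 = 1 ∧ a < e ∧ b < e ∧ e < a + b)
    + quadCount m (fun a b _ e => (a + b + e) % 2 = 1 ∧ b < a ∧ e < a)
    + quadCount m (fun a b _ e => (a + b + e) % 2 = 1 ∧ a < b ∧ e < b)
    + quadCount m (fun a b _ e => (a + b + e) % 2 = 1 ∧ a = b ∧ e ≤ a)
    + quadCount m (fun a b _ e => (a + b + e) % 2 = 1 ∧ a = e ∧ b < e)
    + quadCount m (fun a b _ e => (a + b + e) % 2 = 1 ∧ b = e ∧ a < e) := by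
  classical
  simp only [quadCount_eq_sum, ← Finset.sum_add_distrib]
  refine Finset.sum_congr rfl fun x hx => ?_
  rw [mem_quads] at hx
  obtain ⟨a, b, c, e⟩ := x
  obtain ⟨ha, hb, hc, he, -⟩ := hx
  dsimp only at *
  by_cases h5 : (a + b + e) % 2 = 1
  · simp only [h5, true_and]
    split_ifs <;> omega
  · simp [h5]

/-- Quadruples coming from solutions of `4m = r² + uv + vw + wu` in odd positive integers
with `r < w`. -/
theorem quadCount_large_w (m : ℤ) :
    2 * quadCount m (fun a b _ e => (a + b + e) % 2 = 1 ∧ a - b < e ∧ b - a < e ∧ e < a + b)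
      + 2 * quadCount m (fun a b c e => (a + b + e) % 2 = 1 ∧ a = e ∧ a < c)
      + 2 * quadCount m (fun a _ c e => (c + e) % 2 = 1 ∧ a = e ∧ c < e)
      + quadCount m (fun a b c e => (a + b + e) % 2 = 1 ∧ a + b < e ∧ e - a - b = c)
    = quadCount m (fun a b c e => (a + b + e) % 2 = 1 ∧ a = c ∧ a < e)
      + 2 * quadCount m (fun a b _ e => (a + b + e) % 2 = 1 ∧ a = e)
      + quadCount m (fun a b _ e => (a + b + e) % 2 = 1 ∧ a = e ∧ b < e)
      + 2 * quadCount m (fun a _ c e => (c + e) % 2 = 1 ∧ a = e ∧ e < c) := by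
  have h1 := quadCount_triangle_e m
  have h2 := quadCount_long_a m
  have s1 : quadCount m (fun a b _ e => (a + b + e) % 2 = 1 ∧ b < a ∧ e < a)
      = quadCount m (fun a b _ e => (a + b + e) % 2 = 1 ∧ a < b ∧ e < b) := by
    rw [quadCount_swap_ab]; exact quadCount_congr (by intros; omega)
  have s2 : quadCount m (fun a b _ e => (a + b + e) % 2 = 1 ∧ b + e < a)
      = quadCount m (fun a b _ e => (a + b + e) % 2 = 1 ∧ a + e < b) := by
    rw [quadCount_swap_ab]; exact quadCount_congr (by intros; omega)
  have s3 : quadCount m (fun a b _ e => (a + b + e) % 2 = 1 ∧ a = e ∧ b < e)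
      = quadCount m (fun a b _ e => (a + b + e) % 2 = 1 ∧ b = e ∧ a < e) := by
    rw [quadCount_swap_ab]; exact quadCount_congr (by intros; omega)
  have s4 : quadCount m (fun a b _ e => (a + b + e) % 2 = 1 ∧ a = e ∧ e < b)
      = quadCount m (fun a b _ e => (a + b + e) % 2 = 1 ∧ b = e ∧ e < a) := by
    rw [quadCount_swap_ab]; exact quadCount_congr (by intros; omega)
  have s5 : quadCount m (fun a b _ e => (a + b + e) % 2 = 1 ∧ b < e ∧ e < a)
      = quadCount m (fun a b _ e => (a + b + e) % 2 = 1 ∧ a < e ∧ e < b) := by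
    rw [quadCount_swap_ab]; exact quadCount_congr (by intros; omega)
  have s6 : quadCount m (fun a b _ e => (a + b + e) % 2 = 1 ∧ e < b ∧ b < a)
      = quadCount m (fun a b _ e => (a + b + e) % 2 = 1 ∧ e < a ∧ a < b) := by
    rw [quadCount_swap_ab]; exact quadCount_congr (by intros; omega)
  have key := quadCount_triangle m
  have d1 : quadCount m (fun a b _ e => (a + b + e) % 2 = 1 ∧ a = b ∧ e ≤ a)
      = quadCount m (fun a b _ e => (a + b + e) % 2 = 1 ∧ a = b ∧ e < a)
      + quadCount m (fun a b _ e => (a + b + e) % 2 = 1 ∧ a = b ∧ a = e) :=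
    quadCount_add (by intros; omega)
  have d2 : quadCount m (fun a b _ e => (a + b + e) % 2 = 1 ∧ a = e)
      = quadCount m (fun a b _ e => (a + b + e) % 2 = 1 ∧ a = e ∧ b < e)
      + quadCount m (fun a b _ e => (a + b + e) % 2 = 1 ∧ a = e ∧ e ≤ b) :=
    quadCount_add (by intros; omega)
  have d3 : quadCount m (fun a b _ e => (a + b + e) % 2 = 1 ∧ a = e ∧ e ≤ b)
      = quadCount m (fun a b _ e => (a + b + e) % 2 = 1 ∧ a = e ∧ e < b)
      + quadCount m (fun a b _ e => (a + b + e) % 2 = 1 ∧ a = b ∧ a = e) :=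
    quadCount_add (by intros; omega)
  have d4 : quadCount m (fun a b _ e => (a + b + e) % 2 = 1 ∧ a < e)
      = quadCount m (fun a b _ e => (a + b + e) % 2 = 1 ∧ a < e ∧ b < e)
      + quadCount m (fun a b _ e => (a + b + e) % 2 = 1 ∧ a < e ∧ e ≤ b) :=
    quadCount_add (by intros; omega)
  have d5 : quadCount m (fun a b _ e => (a + b + e) % 2 = 1 ∧ a < e ∧ e ≤ b)
      = quadCount m (fun a b _ e => (a + b + e) % 2 = 1 ∧ a < e ∧ e < b)
      + quadCount m (fun a b _ e => (a + b + e) % 2 = 1 ∧ b = e ∧ a < e) :=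
    quadCount_add (by intros; omega)
  have d6 : quadCount m (fun a b _ e => (a + b + e) % 2 = 1 ∧ e < a)
      = quadCount m (fun a b _ e => (a + b + e) % 2 = 1 ∧ b < a ∧ e < a)
      + quadCount m (fun a b _ e => (a + b + e) % 2 = 1 ∧ e < a ∧ a ≤ b) :=
    quadCount_add (by intros; omega)
  have d7 : quadCount m (fun a b _ e => (a + b + e) % 2 = 1 ∧ e < a ∧ a ≤ b)
      = quadCount m (fun a b _ e => (a + b + e) % 2 = 1 ∧ e < a ∧ a < b)
      + quadCount m (fun a b _ e => (a + b + e) % 2 = 1 ∧ a = b ∧ e < a) :=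
    quadCount_add (by intros; omega)
  have d8 : quadCount m (fun a b _ e => (a + b + e) % 2 = 1 ∧ b < a ∧ e < a)
      = quadCount m (fun a b _ e => (a + b + e) % 2 = 1 ∧ e < b ∧ b < a)
      + quadCount m (fun a b _ e => (a + b + e) % 2 = 1 ∧ b ≤ e ∧ e < a) :=
    quadCount_add (by intros; omega)
  have d9 : quadCount m (fun a b _ e => (a + b + e) % 2 = 1 ∧ b ≤ e ∧ e < a)
      = quadCount m (fun a b _ e => (a + b + e) % 2 = 1 ∧ b < e ∧ e < a)
      + quadCount m (fun a b _ e => (a + b + e) % 2 = 1 ∧ b = e ∧ e < a) :=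
    quadCount_add (by intros; omega)
  omega

open Classical in
/-- The sum over all factorizations `f * h = m` of the number of integers `0 < k < f + h`
satisfying `R f h k`. -/
noncomputable def factorCount (m : ℕ) (R : ℤ → ℤ → ℤ → Prop) : ℕ :=
  ∑ x ∈ m.divisorsAntidiagonal,
    ((Finset.Ioo (0 : ℤ) ((x.1 : ℤ) + x.2)).filter (R x.1 x.2)).card

theorem quadCount_eq_factorCount {m : ℕ} (hm : 0 < m) {P : ℤ → ℤ → ℤ → ℤ → Prop}
    {R : ℤ → ℤ → ℤ → Prop} (φ : ℤ → ℤ → ℤ → ℤ → ℤ × ℤ × ℤ) (ψ : ℤ → ℤ → ℤ → ℤ × ℤ × ℤ × ℤ)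
    (hφ : ∀ a b c e, 0 < a → 0 < b → 0 < c → 0 < e → P a b c e →
      0 < (φ a b c e).1 ∧ 0 < (φ a b c e).2.1 ∧ 0 < (φ a b c e).2.2 ∧
      (φ a b c e).2.2 < (φ a b c e).1 + (φ a b c e).2.1 ∧
      R (φ a b c e).1 (φ a b c e).2.1 (φ a b c e).2.2)
    (hφm : ∀ a b c e, P a b c e → (φ a b c e).1 * (φ a b c e).2.1 = a * b + c * e)
    (hψφ : ∀ a b c e, P a b c e →
      ψ (φ a b c e).1 (φ a b c e).2.1 (φ a b c e).2.2 = (a, b, c, e))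
    (hψ : ∀ f h k, 0 < f → 0 < h → 0 < k → R f h k →
      0 < (ψ f h k).1 ∧ 0 < (ψ f h k).2.1 ∧ 0 < (ψ f h k).2.2.1 ∧ 0 < (ψ f h k).2.2.2 ∧
      P (ψ f h k).1 (ψ f h k).2.1 (ψ f h k).2.2.1 (ψ f h k).2.2.2)
    (hφψ : ∀ f h k, R f h k →
      φ (ψ f h k).1 (ψ f h k).2.1 (ψ f h k).2.2.1 (ψ f h k).2.2.2 = (f, h, k)) :
    quadCount m P = factorCount m R := by
  classical
  rw [factorCount, ← Finset.card_sigma, quadCount]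
  refine Finset.card_bij'
    (fun x _ => (⟨((φ x.1 x.2.1 x.2.2.1 x.2.2.2).1.toNat, (φ x.1 x.2.1 x.2.2.1 x.2.2.2).2.1.toNat),
      (φ x.1 x.2.1 x.2.2.1 x.2.2.2).2.2⟩ : Σ _ : ℕ × ℕ, ℤ))
    (fun y _ => ψ y.1.1 y.1.2 y.2) ?_ ?_ ?_ ?_
  · rintro ⟨a, b, c, e⟩ hx
    simp only [Finset.mem_filter, mem_quads] at hx
    obtain ⟨⟨ha, hb, hc, he, hs⟩, hP⟩ := hx
    obtain ⟨h1, h2, h3, h4, h5⟩ := hφ a b c e ha hb hc he hP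
    have h6 := hφm a b c e hP
    simp only [Finset.mem_sigma, Nat.mem_divisorsAntidiagonal, Finset.mem_filter,
      Finset.mem_Ioo, Int.toNat_of_nonneg h1.le, Int.toNat_of_nonneg h2.le]
    refine ⟨⟨?_, hm.ne'⟩, ⟨h3, h4⟩, h5⟩
    zify
    rw [Int.toNat_of_nonneg h1.le, Int.toNat_of_nonneg h2.le, h6, hs]
  · rintro ⟨⟨f, h⟩, k⟩ hy
    simp only [Finset.mem_sigma, Nat.mem_divisorsAntidiagonal, Finset.mem_filter,
      Finset.mem_Ioo] at hy
    obtain ⟨⟨hfh, -⟩, ⟨hk, -⟩, hR⟩ := hy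
    have hf : 0 < f := Nat.pos_of_ne_zero (by rintro rfl; omega)
    have hh : 0 < h := Nat.pos_of_ne_zero (by rintro rfl; omega)
    obtain ⟨h1, h2, h3, h4, h5⟩ := hψ f h k (by exact_mod_cast hf) (by exact_mod_cast hh) hk hR
    simp only [Finset.mem_filter, mem_quads]
    refine ⟨⟨h1, h2, h3, h4, ?_⟩, h5⟩
    rw [← hφm _ _ _ _ h5, hφψ _ _ _ hR]
    dsimp only
    exact_mod_cast hfh
  · rintro ⟨a, b, c, e⟩ hx
    simp only [Finset.mem_filter, mem_quads] at hx
    obtain ⟨⟨ha, hb, hc, he, hs⟩, hP⟩ := hx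
    obtain ⟨h1, h2, h3, h4, h5⟩ := hφ a b c e ha hb hc he hP
    simp only [Int.toNat_of_nonneg h1.le, Int.toNat_of_nonneg h2.le]
    exact hψφ a b c e hP
  · rintro ⟨⟨f, h⟩, k⟩ hy
    simp only [Finset.mem_sigma, Nat.mem_divisorsAntidiagonal, Finset.mem_filter,
      Finset.mem_Ioo] at hy
    simp [hφψ _ _ _ hy.2.2]

theorem card_eq_of_arith {s : Finset ℤ} (α d : ℤ) (hd : 0 < d) (n : ℕ)
    (h : ∀ k, k ∈ s ↔ ∃ i : ℕ, i < n ∧ k = α + d * i) : s.card = n := by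
  have : s = (Finset.range n).image fun i : ℕ => α + d * i := by
    ext k
    simp only [h, Finset.mem_image, Finset.mem_range, eq_comm]
  rw [this, Finset.card_image_of_injective, Finset.card_range]
  intro i j hij
  simpa [hd.ne'] using hij

theorem factorCount_eq {m : ℕ} {R : ℤ → ℤ → ℤ → Prop} (F : ℤ → ℤ → ℤ)
    (α d : ℤ → ℤ → ℤ) (hd : ∀ f h, 0 < d f h)
    (hF : ∀ f h, 0 < f → 0 < h → 0 ≤ F f h)
    (h1 : ∀ f h k, 0 < f → 0 < h → 0 < k → R f h k → ∃ i, 0 ≤ i ∧ i < F f h ∧ k = α f h + d f h * i)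
    (h2 : ∀ f h i, 0 < f → 0 < h → 0 ≤ i → i < F f h → 0 < α f h + d f h * i ∧
      α f h + d f h * i < f + h ∧ R f h (α f h + d f h * i)) :
    (factorCount m R : ℤ) = ∑ x ∈ m.divisorsAntidiagonal, F x.1 x.2 := by
  classical
  rw [factorCount, Nat.cast_sum]
  refine Finset.sum_congr rfl ?_
  rintro ⟨f, h⟩ hx
  rw [Nat.mem_divisorsAntidiagonal] at hx
  dsimp only at hx ⊢
  have hf : 0 < f := Nat.pos_of_ne_zero (by rintro rfl; omega)
  have hh : 0 < h := Nat.pos_of_ne_zero (by rintro rfl; omega)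
  have hf' : (0 : ℤ) < f := by exact_mod_cast hf
  have hh' : (0 : ℤ) < h := by exact_mod_cast hh
  rw [card_eq_of_arith (α f h) (d f h) (hd f h) (F f h).toNat, Int.toNat_of_nonneg (hF f h hf' hh')]
  intro k
  simp only [Finset.mem_filter, Finset.mem_Ioo]
  constructor
  · rintro ⟨⟨hk, -⟩, hR⟩
    obtain ⟨i, hi, hi', rfl⟩ := h1 f h k hf' hh' hk hR
    exact ⟨i.toNat, by omega, by rw [Int.toNat_of_nonneg hi]⟩
  · rintro ⟨i, hi, rfl⟩
    obtain ⟨h3, h4, h5⟩ := h2 f h i hf' hh' (by omega) (by omega)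
    exact ⟨⟨h3, h4⟩, h5⟩

theorem sum_divisorsAntidiagonal_congr_symm {m : ℕ} {G K : ℤ → ℤ → ℤ}
    (h : ∀ f h, 0 < f → 0 < h → G f h + G h f = K f h + K h f) :
    ∑ x ∈ m.divisorsAntidiagonal, G x.1 x.2 = ∑ x ∈ m.divisorsAntidiagonal, K x.1 x.2 := by
  have hs : ∀ G : ℤ → ℤ → ℤ, ∑ x ∈ m.divisorsAntidiagonal, G x.2 x.1
      = ∑ x ∈ m.divisorsAntidiagonal, G x.1 x.2 := fun G =>
    Nat.sum_divisorsAntidiagonal' (n := m) (f := fun x y => G y x) |>.trans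
      (Nat.sum_divisorsAntidiagonal (n := m) (f := fun x y => G x y)).symm
  have h2 : ∑ x ∈ m.divisorsAntidiagonal, (G x.1 x.2 + G x.2 x.1)
      = ∑ x ∈ m.divisorsAntidiagonal, (K x.1 x.2 + K x.2 x.1) := by
    refine Finset.sum_congr rfl fun x hx => h _ _ ?_ ?_
    · exact_mod_cast (Nat.pos_of_mem_divisors (Nat.fst_mem_divisors_of_mem_antidiagonal hx))
    · exact_mod_cast (Nat.pos_of_mem_divisors (Nat.snd_mem_divisors_of_mem_antidiagonal hx))
  rw [Finset.sum_add_distrib, Finset.sum_add_distrib, hs G, hs K] at h2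
  omega

section boundary

variable {m : ℕ} (hm : 0 < m)
include hm

theorem quadCount_ce_odd_a_eq_e_lt_c :
    (quadCount m (fun a _ c e => (c + e) % 2 = 1 ∧ a = e ∧ e < c) : ℤ)
    = ∑ x ∈ m.divisorsAntidiagonal, max (((x.2 : ℤ) - x.1) / 2) 0 := by
  rw [quadCount_eq_factorCount hm (R := fun f h k => (k + f) % 2 = 1 ∧ f < k ∧ k < h)
    (fun a b c _ => (a, b + c, c)) (fun f h k => (f, h - k, k, f)),
    factorCount_eq (fun f h => max ((h - f) / 2) 0) (fun f _ => f + 1) (fun _ _ => 2)]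
  · intros; norm_num
  · intros; omega
  · intro f h k _ _ _ hR; exact ⟨(k - f - 1) / 2, by omega⟩
  · intros; omega
  · intros; dsimp only; omega
  · rintro a b c e ⟨-, rfl, -⟩; dsimp only; ring
  · rintro a b c e ⟨-, rfl, -⟩; ext <;> dsimp only; ring
  · intros; dsimp only; omega
  · intros; ext <;> dsimp only; ring

theorem quadCount_ce_odd_a_eq_two_e :
    (quadCount m (fun a _ c e => (c + e) % 2 = 1 ∧ a = 2 * e ∧ e < c) : ℤ)
    = ∑ x ∈ m.divisorsAntidiagonal,
      if ((x.1 : ℤ) + x.2) % 2 = 1 then max (((x.2 : ℤ) - x.1 - 1) / 2) 0 else 0 := by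
  rw [quadCount_eq_factorCount hm (R := fun f h k => (f + h) % 2 = 1 ∧ f < h - 2 * k)
    (fun a b c e => (e, 2 * b + c, b)) (fun f h k => (2 * f, k, h - 2 * k, f)),
    factorCount_eq (fun f h => if (f + h) % 2 = 1 then max ((h - f - 1) / 2) 0 else 0)
      (fun _ _ => 1) (fun _ _ => 1)]
  · intros; norm_num
  · intros; split_ifs <;> omega
  · intro f h k _ _ _ hR; exact ⟨k - 1, by rw [if_pos hR.1]; omega⟩
  · intros f h i _ _ _ hi; split_ifs at hi <;> omega
  · intros; dsimp only; omega
  · rintro a b c e ⟨-, rfl, -⟩; dsimp only; ring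
  · rintro a b c e ⟨-, rfl, -⟩; ext <;> dsimp only; ring
  · intros; dsimp only; omega
  · intros; ext <;> dsimp only; ring

theorem quadCount_ce_odd_sub_eq_add :
    (quadCount m (fun a b c e => (c + e) % 2 = 1 ∧ c - e = a + b ∧ a < b) : ℤ)
    = ∑ x ∈ m.divisorsAntidiagonal,
      if ((x.1 : ℤ) + x.2) % 2 = 1 ∧ (x.1 : ℤ) < x.2 then (x.1 : ℤ) - 1 else 0 := by
  rw [quadCount_eq_factorCount hm (R := fun f h k => ((f + h) % 2 = 1 ∧ f < h) ∧ k < f)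
    (fun a b c e => (a + e, b + e, a)) (fun f h k => (k, h - f + k, h + k, f - k)),
    factorCount_eq (fun f h => if (f + h) % 2 = 1 ∧ f < h then f - 1 else 0)
      (fun _ _ => 1) (fun _ _ => 1)]
  · intros; norm_num
  · intros; split_ifs <;> omega
  · intro f h k _ _ _ hR; exact ⟨k - 1, by rw [if_pos hR.1]; omega⟩
  · intros f h i _ _ _ hi; split_ifs at hi <;> omega
  · intros; dsimp only; omega
  · rintro a b c e ⟨-, h, -⟩; obtain rfl : c = a + b + e := by omega
    dsimp only; ring
  · rintro a b c e ⟨-, h, -⟩; obtain rfl : c = a + b + e := by omega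
    ext <;> dsimp only <;> ring
  · intros; dsimp only; omega
  · intros; ext <;> dsimp only <;> ring

theorem quadCount_abe_odd_a_eq_e_lt_c :
    (quadCount m (fun a b c e => (a + b + e) % 2 = 1 ∧ a = e ∧ a < c) : ℤ)
    = ∑ x ∈ m.divisorsAntidiagonal, max (((x.2 : ℤ) - x.1) / 2) 0 := by
  rw [quadCount_eq_factorCount hm (R := fun f h k => k % 2 = 1 ∧ f < h - k)
    (fun a b c _ => (a, b + c, b)) (fun f h k => (f, k, h - k, f)),
    factorCount_eq (fun f h => max ((h - f) / 2) 0) (fun _ _ => 1) (fun _ _ => 2)]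
  · intros; norm_num
  · intros; omega
  · intro f h k _ _ _ hR; exact ⟨k / 2, by omega⟩
  · intros; omega
  · intros; dsimp only; omega
  · rintro a b c e ⟨-, rfl, -⟩; dsimp only; ring
  · rintro a b c e ⟨-, rfl, -⟩; ext <;> dsimp only; ring
  · intros; dsimp only; omega
  · intros; ext <;> dsimp only; ring

theorem quadCount_ce_odd_a_eq_e_gt_c :
    (quadCount m (fun a _ c e => (c + e) % 2 = 1 ∧ a = e ∧ c < e) : ℤ)
    = ∑ x ∈ m.divisorsAntidiagonal,
      if (x.1 : ℤ) ≤ x.2 ∨ ((x.1 : ℤ) + x.2) % 2 = 0 then min (x.1 : ℤ) x.2 / 2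
      else ((x.2 : ℤ) - 1) / 2 := by
  rw [quadCount_eq_factorCount hm (R := fun f h k => (k + f) % 2 = 1 ∧ k < f ∧ k < h)
    (fun a b c _ => (a, b + c, c)) (fun f h k => (f, h - k, k, f)),
    factorCount_eq (fun f h => if f ≤ h ∨ (f + h) % 2 = 0 then min f h / 2 else (h - 1) / 2)
      (fun f _ => 1 + f % 2) (fun _ _ => 2)]
  · intros; norm_num
  · intros; split_ifs <;> omega
  · intro f h k _ _ _ hR; exact ⟨(k - 1) / 2, by split_ifs <;> omega⟩
  · intros f h i _ _ _ hi; split_ifs at hi <;> omega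
  · intros; dsimp only; omega
  · rintro a b c e ⟨-, rfl, -⟩; dsimp only; ring
  · rintro a b c e ⟨-, rfl, -⟩; ext <;> dsimp only; ring
  · intros; dsimp only; omega
  · intros; ext <;> dsimp only; ring

theorem quadCount_abe_odd_a_eq_c_lt_e :
    (quadCount m (fun a b c e => (a + b + e) % 2 = 1 ∧ a = c ∧ a < e) : ℤ)
    = ∑ x ∈ m.divisorsAntidiagonal,
      if ((x.1 : ℤ) + x.2) % 2 = 1 then max ((x.2 : ℤ) - x.1 - 1) 0 else 0 := by
  rw [quadCount_eq_factorCount hm (R := fun f h k => (f + h) % 2 = 1 ∧ f < k ∧ k < h)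
    (fun a b c e => (a, b + e, e)) (fun f h k => (f, h - k, f, k)),
    factorCount_eq (fun f h => if (f + h) % 2 = 1 then max (h - f - 1) 0 else 0)
      (fun f _ => f + 1) (fun _ _ => 1)]
  · intros; norm_num
  · intros; split_ifs <;> omega
  · intro f h k _ _ _ hR; exact ⟨k - f - 1, by rw [if_pos hR.1]; omega⟩
  · intros f h i _ _ _ hi; split_ifs at hi <;> omega
  · intros; dsimp only; omega
  · rintro a b c e ⟨-, rfl, -⟩; dsimp only; ring
  · rintro a b c e ⟨-, rfl, -⟩; ext <;> dsimp only; ring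
  · intros; dsimp only; omega
  · intros; ext <;> dsimp only; ring

theorem quadCount_abe_odd_a_eq_e : (quadCount m (fun a b _ e => (a + b + e) % 2 = 1 ∧ a = e) : ℤ)
    = ∑ x ∈ m.divisorsAntidiagonal, (x.2 : ℤ) / 2 := by
  rw [quadCount_eq_factorCount hm (R := fun f h k => k % 2 = 1 ∧ k < h)
    (fun a b c _ => (a, b + c, b)) (fun f h k => (f, k, h - k, f)),
    factorCount_eq (fun _ h => h / 2) (fun _ _ => 1) (fun _ _ => 2)]
  · intros; norm_num
  · intros; omega
  · intro f h k _ _ _ hR; exact ⟨k / 2, by omega⟩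
  · intros; omega
  · intros; dsimp only; omega
  · rintro a b c e ⟨-, rfl⟩; dsimp only; ring
  · rintro a b c e ⟨-, rfl⟩; ext <;> dsimp only; ring
  · intros; dsimp only; omega
  · intros; ext <;> dsimp only; ring

theorem quadCount_abe_odd_a_eq_e_gt_b :
    quadCount m (fun a b _ e => (a + b + e) % 2 = 1 ∧ a = e ∧ b < e)
    = quadCount m (fun a b c e => (a + b + e) % 2 = 1 ∧ a + b < e ∧ e - a - b = c) := by
  rw [quadCount_eq_factorCount hm (R := fun f h k => k % 2 = 1 ∧ k < f ∧ k < h)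
    (fun a b c _ => (a, b + c, b)) (fun f h k => (f, k, h - k, f)),
    quadCount_eq_factorCount hm (R := fun f h k => k % 2 = 1 ∧ k < f ∧ k < h)
    (fun a b c _ => (a + c, b + c, c)) (fun f h k => (f - k, h - k, k, f + h - k))]
  · intros; dsimp only; omega
  · rintro a b c e ⟨-, -, h⟩; obtain rfl : e = a + b + c := by omega
    dsimp only; ring
  · rintro a b c e ⟨-, -, h⟩; obtain rfl : e = a + b + c := by omega
    ext <;> dsimp only <;> ring
  · intros; dsimp only; omega
  · intros; ext <;> dsimp only <;> ring
  · intros; dsimp only; omega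
  · rintro a b c e ⟨-, rfl, -⟩; dsimp only; ring
  · rintro a b c e ⟨-, rfl, -⟩; ext <;> dsimp only; ring
  · intros; dsimp only; omega
  · intros; ext <;> dsimp only; ring

theorem quadCount_total :
    2 * (quadCount m (fun a b c e => (c + e) % 2 = 1 ∧ e < c ∧ c - e < 2 * a ∧ c - e < 2 * b) : ℤ)
      + 2 * (quadCount m
        (fun a b _ e => (a + b + e) % 2 = 1 ∧ a - b < e ∧ b - a < e ∧ e < a + b) : ℤ)
      + 2 * ∑ x ∈ m.divisorsAntidiagonal, min (x.1 : ℤ) x.2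
    = ∑ x ∈ m.divisorsAntidiagonal,
      if ((x.1 : ℤ) + x.2) % 2 = 1 then 4 * (x.1 : ℤ) - 3 * min (x.1 : ℤ) x.2
      else 2 * (x.1 : ℤ) := by
  have h1 := quadCount_small_w m
  have h2 := quadCount_large_w m
  rw [← quadCount_abe_odd_a_eq_e_gt_b hm] at h2
  zify at h1 h2
  rw [quadCount_ce_odd_a_eq_e_lt_c hm, quadCount_ce_odd_a_eq_two_e hm,
    quadCount_ce_odd_sub_eq_add hm] at h1
  rw [quadCount_ce_odd_a_eq_e_lt_c hm, quadCount_abe_odd_a_eq_e_lt_c hm,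
    quadCount_ce_odd_a_eq_e_gt_c hm, quadCount_abe_odd_a_eq_c_lt_e hm, quadCount_abe_odd_a_eq_e hm] at h2
  rw [← eq_sub_iff_add_eq] at h1
  rw [h1]
  have key := sum_divisorsAntidiagonal_congr_symm (m := m)
    (G := fun f h => 2 * max ((h - f) / 2) 0
      + 2 * (if (f + h) % 2 = 1 then max ((h - f - 1) / 2) 0 else 0)
      - 2 * (if (f + h) % 2 = 1 ∧ f < h then f - 1 else 0)
      + (if (f + h) % 2 = 1 then max (h - f - 1) 0 else 0)
      + 2 * (h / 2)
      - 2 * (if f ≤ h ∨ (f + h) % 2 = 0 then min f h / 2 else (h - 1) / 2)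
      + 2 * min f h)
    (K := fun f h => if (f + h) % 2 = 1 then 4 * f - 3 * min f h else 2 * f) (by
      intro f h hf hh
      rw [add_comm h f, min_comm h f]
      rcases Int.emod_two_eq_zero_or_one (f + h) with h0 | h0
      · simp only [h0]
        norm_num
        omega
      · simp only [h0]
        norm_num
        rcases lt_trichotomy f h with h3 | h3 | h3
        · simp only [h3, h3.not_gt, h3.le, h3.not_ge, if_true, if_false]
          omega
        · omega
        · simp only [h3, h3.not_gt, h3.le, h3.not_ge, if_true, if_false]
          omega)
  rw [← key]
  simp only [Finset.sum_add_distrib, Finset.sum_sub_distrib, ← Finset.mul_sum]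
  linarith

end boundary

/-- Triples of odd positive integers with `u * v + v * w + w * u = n`. -/
noncomputable def oddTriples (n : ℤ) : Finset (ℤ × ℤ × ℤ) :=
  (Finset.Icc 1 n ×ˢ Finset.Icc 1 n ×ˢ Finset.Icc 1 n).filter fun x =>
    (x.1 % 2 = 1 ∧ x.2.1 % 2 = 1 ∧ x.2.2 % 2 = 1) ∧
      x.1 * x.2.1 + x.2.1 * x.2.2 + x.2.2 * x.1 = n

theorem mem_oddTriples {n u v w : ℤ} : (u, v, w) ∈ oddTriples n ↔
    (0 < u ∧ 0 < v ∧ 0 < w) ∧ (u % 2 = 1 ∧ v % 2 = 1 ∧ w % 2 = 1) ∧ u * v + v * w + w * u = n := by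
  simp only [oddTriples, Finset.mem_filter, Finset.mem_product, Finset.mem_Icc]
  constructor
  · rintro ⟨⟨⟨hu, -⟩, ⟨hv, -⟩, hw, -⟩, h⟩
    exact ⟨⟨hu, hv, hw⟩, h⟩
  · rintro ⟨⟨hu, hv, hw⟩, ho, h⟩
    have h1 : 0 < u * v := mul_pos hu hv
    have h2 : 0 < v * w := mul_pos hv hw
    have h3 : 0 < w * u := mul_pos hw hu
    refine ⟨⟨⟨hu, ?_⟩, ⟨hv, ?_⟩, hw, ?_⟩, ho, h⟩ <;> nlinarith

theorem sum_card_oddTriples {m : ℕ} (hm : 0 < m) :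
    ∑ r ∈ (Finset.Ioo (0 : ℤ) (2 * m + 1)).filter (fun r => r % 2 = 1),
      (oddTriples (4 * m - r ^ 2)).card
    = quadCount m (fun a b c e => (c + e) % 2 = 1 ∧ e < c ∧ c - e < 2 * a ∧ c - e < 2 * b)
      + quadCount m (fun a b _ e => (a + b + e) % 2 = 1 ∧ a - b < e ∧ b - a < e ∧ e < a + b)
      + ∑ x ∈ m.divisorsAntidiagonal, min x.1 x.2 := by
  classical
  rw [← Finset.card_sigma]
  set Z := ((Finset.Ioo (0 : ℤ) (2 * m + 1)).filter (fun r => r % 2 = 1)).sigma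
    fun r => oddTriples (4 * m - r ^ 2) with hZ
  have memZ : ∀ r u v w : ℤ, (⟨r, u, v, w⟩ : Σ _ : ℤ, ℤ × ℤ × ℤ) ∈ Z ↔
      (0 < r ∧ 0 < u ∧ 0 < v ∧ 0 < w) ∧ (r % 2 = 1 ∧ u % 2 = 1 ∧ v % 2 = 1 ∧ w % 2 = 1) ∧
        u * v + v * w + w * u = 4 * m - r ^ 2 := by
    intro r u v w
    simp only [hZ, Finset.mem_sigma, Finset.mem_filter, Finset.mem_Ioo, mem_oddTriples]
    constructor
    · rintro ⟨⟨⟨h1, -⟩, h2⟩, ⟨h3, h4, h5⟩, ⟨h6, h7, h8⟩, h9⟩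
      exact ⟨⟨h1, h3, h4, h5⟩, ⟨h2, h6, h7, h8⟩, h9⟩
    · rintro ⟨⟨h1, h3, h4, h5⟩, ⟨h2, h6, h7, h8⟩, h9⟩
      refine ⟨⟨⟨h1, ?_⟩, h2⟩, ⟨h3, h4, h5⟩, ⟨h6, h7, h8⟩, h9⟩
      nlinarith [mul_pos h3 h4, mul_pos h4 h5, mul_pos h5 h3, sq_nonneg (r - 2)]
  have hlt : (Z.filter fun x => x.2.2.2 < x.1).card = quadCount m
      (fun a b c e => (c + e) % 2 = 1 ∧ e < c ∧ c - e < 2 * a ∧ c - e < 2 * b) := by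
    refine Finset.card_bij'
      (fun x _ => ((x.2.1 + x.2.2.2) / 2, (x.2.2.1 + x.2.2.2) / 2, (x.1 + x.2.2.2) / 2,
        (x.1 - x.2.2.2) / 2))
      (fun y _ => (⟨y.2.2.1 + y.2.2.2, 2 * y.1 - y.2.2.1 + y.2.2.2, 2 * y.2.1 - y.2.2.1 + y.2.2.2,
        y.2.2.1 - y.2.2.2⟩ : Σ _ : ℤ, ℤ × ℤ × ℤ)) ?_ ?_ ?_ ?_
    · rintro ⟨r, u, v, w⟩ hx
      simp only [Finset.mem_filter, memZ] at hx
      obtain ⟨⟨hpos, hodd, h⟩, hw⟩ := hx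
      obtain ⟨A, hA⟩ : ∃ A, u = 2 * A - w := ⟨(u + w) / 2, by omega⟩
      obtain ⟨B, hB⟩ : ∃ B, v = 2 * B - w := ⟨(v + w) / 2, by omega⟩
      obtain ⟨E, hE⟩ : ∃ E, r = 2 * E + w := ⟨(r - w) / 2, by omega⟩
      have e1 : (u + w) / 2 = A := by omega
      have e2 : (v + w) / 2 = B := by omega
      have e3 : (r + w) / 2 = E + w := by omega
      have e4 : (r - w) / 2 = E := by omega
      simp only [Finset.mem_filter, mem_quads, e1, e2, e3, e4]
      refine ⟨⟨by omega, by omega, by omega, by omega, ?_⟩, by omega⟩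
      subst hA hB hE
      linarith
    · rintro ⟨a, b, c, e⟩ hy
      simp only [Finset.mem_filter, mem_quads] at hy
      obtain ⟨⟨ha, hb, hc, he, h⟩, hy⟩ := hy
      simp only [Finset.mem_filter, memZ]
      refine ⟨⟨by omega, by omega, ?_⟩, by omega⟩
      linarith
    · rintro ⟨r, u, v, w⟩ hx
      simp only [Finset.mem_filter, memZ] at hx
      ext <;> simp <;> omega
    · rintro ⟨a, b, c, e⟩ hy
      ext <;> dsimp only <;> omega
  have hgt : (Z.filter fun x => x.1 < x.2.2.2).card = quadCount m
      (fun a b _ e => (a + b + e) % 2 = 1 ∧ a - b < e ∧ b - a < e ∧ e < a + b) := by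
    refine Finset.card_bij'
      (fun x _ => ((x.2.1 + x.1) / 2, (x.2.2.1 + x.1) / 2, (x.2.2.2 - x.1) / 2,
        (x.2.1 + x.2.2.1) / 2))
      (fun y _ => (⟨y.1 + y.2.1 - y.2.2.2, y.2.2.2 + y.1 - y.2.1, y.2.2.2 - y.1 + y.2.1,
        2 * y.2.2.1 + y.1 + y.2.1 - y.2.2.2⟩ : Σ _ : ℤ, ℤ × ℤ × ℤ)) ?_ ?_ ?_ ?_
    · rintro ⟨r, u, v, w⟩ hx
      simp only [Finset.mem_filter, memZ] at hx
      obtain ⟨⟨hpos, hodd, h⟩, hw⟩ := hx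
      obtain ⟨A, hA⟩ : ∃ A, u = 2 * A - r := ⟨(u + r) / 2, by omega⟩
      obtain ⟨B, hB⟩ : ∃ B, v = 2 * B - r := ⟨(v + r) / 2, by omega⟩
      obtain ⟨C, hC⟩ : ∃ C, w = 2 * C + r := ⟨(w - r) / 2, by omega⟩
      have e1 : (u + r) / 2 = A := by omega
      have e2 : (v + r) / 2 = B := by omega
      have e3 : (w - r) / 2 = C := by omega
      have e4 : (u + v) / 2 = A + B - r := by omega
      simp only [Finset.mem_filter, mem_quads, e1, e2, e3, e4]
      refine ⟨⟨by omega, by omega, by omega, by omega, ?_⟩, by omega⟩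
      subst hA hB hC
      linarith
    · rintro ⟨a, b, c, e⟩ hy
      simp only [Finset.mem_filter, mem_quads] at hy
      obtain ⟨⟨ha, hb, hc, he, h⟩, hy⟩ := hy
      simp only [Finset.mem_filter, memZ]
      refine ⟨⟨by omega, by omega, ?_⟩, by omega⟩
      linarith
    · rintro ⟨r, u, v, w⟩ hx
      simp only [Finset.mem_filter, memZ] at hx
      ext <;> simp <;> omega
    · rintro ⟨a, b, c, e⟩ hy
      ext <;> dsimp only <;> omega
  have heq : (Z.filter fun x => x.1 = x.2.2.2).card
      = ∑ x ∈ m.divisorsAntidiagonal, min x.1 x.2 := by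
    trans ∑ x ∈ m.divisorsAntidiagonal, (Finset.range (min x.1 x.2)).card
    swap
    · simp
    rw [← Finset.card_sigma]
    refine Finset.card_bij'
      (fun x _ => (⟨(((x.2.1 + x.1) / 2).toNat, ((x.2.2.1 + x.1) / 2).toNat), (x.1 / 2).toNat⟩ :
        Σ _ : ℕ × ℕ, ℕ))
      (fun y _ => (⟨2 * y.2 + 1, 2 * y.1.1 - (2 * y.2 + 1), 2 * y.1.2 - (2 * y.2 + 1),
        2 * y.2 + 1⟩ : Σ _ : ℤ, ℤ × ℤ × ℤ)) ?_ ?_ ?_ ?_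
    · rintro ⟨r, u, v, w⟩ hx
      simp only [Finset.mem_filter, memZ] at hx
      obtain ⟨⟨hpos, hodd, h⟩, hw⟩ := hx
      obtain ⟨A, hA⟩ : ∃ A : ℕ, u = 2 * A - r := ⟨((u + r) / 2).toNat, by omega⟩
      obtain ⟨B, hB⟩ : ∃ B : ℕ, v = 2 * B - r := ⟨((v + r) / 2).toNat, by omega⟩
      have e1 : ((u + r) / 2).toNat = A := by omega
      have e2 : ((v + r) / 2).toNat = B := by omega
      simp only [Finset.mem_sigma, Nat.mem_divisorsAntidiagonal, Finset.mem_range, e1, e2]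
      refine ⟨⟨?_, hm.ne'⟩, by omega⟩
      subst hA hB hw
      zify
      linarith
    · rintro ⟨⟨f, h⟩, k⟩ hy
      simp only [Finset.mem_sigma, Nat.mem_divisorsAntidiagonal, Finset.mem_range] at hy
      obtain ⟨⟨h1, -⟩, h2⟩ := hy
      simp only [Finset.mem_filter, memZ]
      refine ⟨⟨by omega, by omega, ?_⟩, trivial⟩
      zify at h1
      linarith
    · rintro ⟨r, u, v, w⟩ hx
      simp only [Finset.mem_filter, memZ] at hx
      ext <;> simp <;> omega
    · rintro ⟨⟨f, h⟩, k⟩ hy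
      ext <;> simp <;> omega
  rw [← hlt, ← hgt, ← heq,
    ← Finset.card_filter_add_card_filter_not (s := Z) (fun x => x.2.2.2 < x.1), add_assoc]
  congr 1
  rw [← Finset.card_filter_add_card_filter_not (s := Z.filter fun x => ¬ x.2.2.2 < x.1)
    (fun x => x.1 < x.2.2.2), Finset.filter_filter, Finset.filter_filter]
  congr 2
  · exact Finset.filter_congr fun x _ => by omega
  · exact Finset.filter_congr fun x _ => by omega

theorem qfAct_mul (g h : Matrix.SpecialLinearGroup (Fin 2) ℤ) (Q : ℤ × ℤ × ℤ) :
    qfAct h (qfAct g Q) = qfAct (h * g) Q := by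
  simp only [qfAct, Matrix.SpecialLinearGroup.coe_mul, Matrix.mul_apply, Fin.sum_univ_two]
  ext <;> dsimp only <;> ring

theorem qfAct_one (Q : ℤ × ℤ × ℤ) : qfAct 1 Q = Q := by
  simp [qfAct]

theorem qfRel_equivalence : Equivalence qfRel where
  refl Q := ⟨1, qfAct_one Q⟩
  symm := by
    rintro Q _ ⟨g, rfl⟩
    exact ⟨g⁻¹, by rw [qfAct_mul, inv_mul_cancel, qfAct_one]⟩
  trans := by
    rintro Q _ _ ⟨g, rfl⟩ ⟨h, rfl⟩
    exact ⟨h * g, (qfAct_mul g h Q).symm⟩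

theorem quot_mk_qfRel_eq_iff {Q Q' : ℤ × ℤ × ℤ} :
    Quot.mk qfRel Q = Quot.mk qfRel Q' ↔ qfRel Q Q' := by
  rw [Quot.eq, qfRel_equivalence.eqvGen_iff]

theorem qfRel_iff {a b c : ℤ} {Q : ℤ × ℤ × ℤ} : qfRel (a, b, c) Q ↔
    ∃ p q r s : ℤ, p * s - q * r = 1 ∧ Q = (a * p ^ 2 + b * p * q + c * q ^ 2,
      2 * a * p * r + b * (p * s + q * r) + 2 * c * q * s,
      a * r ^ 2 + b * r * s + c * s ^ 2) := by
  constructor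
  · rintro ⟨g, rfl⟩
    exact ⟨g.1 0 0, g.1 0 1, g.1 1 0, g.1 1 1, by rw [← Matrix.det_fin_two, g.2], rfl⟩
  · rintro ⟨p, q, r, s, h, rfl⟩
    exact ⟨⟨!![p, q; r, s], by rw [Matrix.det_fin_two_of, h]⟩, by simp [qfAct]⟩

theorem discr_eq_of_qfRel {Q Q' : ℤ × ℤ × ℤ} (h : qfRel Q Q') :
    Q'.2.1 ^ 2 - 4 * Q'.1 * Q'.2.2 = Q.2.1 ^ 2 - 4 * Q.1 * Q.2.2 := by
  obtain ⟨a, b, c⟩ := Q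
  obtain ⟨p, q, r, s, hdet, rfl⟩ := qfRel_iff.1 h
  dsimp only
  linear_combination (b ^ 2 - 4 * a * c) * (p * s - q * r + 1) * hdet

theorem fst_pos_of_qfRel {Q Q' : ℤ × ℤ × ℤ} (h : qfRel Q Q') (hQ : 0 < Q.1)
    (hd : Q.2.1 ^ 2 - 4 * Q.1 * Q.2.2 < 0) : 0 < Q'.1 := by
  obtain ⟨a, b, c⟩ := Q
  obtain ⟨p, q, r, s, hdet, rfl⟩ := qfRel_iff.1 h
  dsimp only at *
  have h1 : 4 * a * (a * p ^ 2 + b * p * q + c * q ^ 2)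
      = (2 * a * p + b * q) ^ 2 + (4 * a * c - b ^ 2) * q ^ 2 := by ring
  refine pos_of_mul_pos_right (a := 4 * a) ?_ (by linarith)
  rw [h1]
  rcases eq_or_ne q 0 with rfl | hq
  · have hp : p ≠ 0 := by rintro rfl; simp at hdet
    have : 0 < (2 * a * p) ^ 2 := by positivity
    simpa using this
  · have h2 : 0 < q ^ 2 := by positivity
    nlinarith [sq_nonneg (2 * a * p + b * q), mul_pos (by linarith : 0 < 4 * a * c - b ^ 2) h2]

/-- The form `(u x² + v y² + w (x - y)²) / 2`, for odd `u`, `v`, `w`. -/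
def obtuseForm (x : ℤ × ℤ × ℤ) : ℤ × ℤ × ℤ :=
  ((x.1 + x.2.2) / 2, -x.2.2, (x.2.1 + x.2.2) / 2)

theorem discr_obtuseForm {u v w : ℤ} (hu : u % 2 = 1) (hv : v % 2 = 1) (hw : w % 2 = 1) :
    (obtuseForm (u, v, w)).2.1 ^ 2 - 4 * (obtuseForm (u, v, w)).1 * (obtuseForm (u, v, w)).2.2
      = -(u * v + v * w + w * u) := by
  obtain ⟨a, rfl⟩ : ∃ a, u = 2 * a - w := ⟨(u + w) / 2, by omega⟩
  obtain ⟨b, rfl⟩ : ∃ b, v = 2 * b - w := ⟨(v + w) / 2, by omega⟩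
  simp only [obtuseForm, sub_add_cancel, Int.mul_ediv_cancel_left _ two_ne_zero]
  ring

theorem qfRel_obtuseForm_entries {u v w u' v' w' : ℤ}
    (hu : u % 2 = 1) (hv : v % 2 = 1) (hw : w % 2 = 1)
    (hu' : u' % 2 = 1) (hv' : v' % 2 = 1) (hw' : w' % 2 = 1)
    (h : qfRel (obtuseForm (u, v, w)) (obtuseForm (u', v', w'))) :
    ∃ p q r s : ℤ, p * s - q * r = 1 ∧
      u' = u * (p * (p + r)) + v * (q * (q + s)) + w * ((p - q) * (p - q + (r - s))) ∧
      v' = u * (r * (p + r)) + v * (s * (q + s)) + w * ((r - s) * (p - q + (r - s))) ∧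
      w' = -(u * (p * r) + v * (q * s) + w * ((p - q) * (r - s))) := by
  obtain ⟨a, rfl⟩ : ∃ a, u = 2 * a - w := ⟨(u + w) / 2, by omega⟩
  obtain ⟨b, rfl⟩ : ∃ b, v = 2 * b - w := ⟨(v + w) / 2, by omega⟩
  obtain ⟨a', rfl⟩ : ∃ a', u' = 2 * a' - w' := ⟨(u' + w') / 2, by omega⟩
  obtain ⟨b', rfl⟩ : ∃ b', v' = 2 * b' - w' := ⟨(v' + w') / 2, by omega⟩
  simp only [obtuseForm, sub_add_cancel, Int.mul_ediv_cancel_left _ (two_ne_zero (α := ℤ))] at h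
  obtain ⟨p, q, r, s, hdet, h⟩ := qfRel_iff.1 h
  simp only [Prod.mk.injEq] at h
  obtain ⟨h1, h2, h3⟩ := h
  refine ⟨p, q, r, s, hdet, ?_, ?_, ?_⟩
  · linear_combination 2 * h1 + h2
  · linear_combination 2 * h3 + h2
  · linear_combination -h2

theorem one_le_sq_add_mul_add_sq {x y : ℤ} (h : x ≠ 0 ∨ y ≠ 0) : 1 ≤ x ^ 2 + x * y + y ^ 2 := by
  rcases h with h | h
  · have : 0 < x ^ 2 := by positivity
    nlinarith [sq_nonneg (x + 2 * y)]
  · have : 0 < y ^ 2 := by positivity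
    nlinarith [sq_nonneg (2 * x + y)]

theorem brackets_of_det {p q r s : ℤ} (hdet : p * s - q * r = 1) :
    1 ≤ p ^ 2 + p * r + r ^ 2 ∧ 1 ≤ q ^ 2 + q * s + s ^ 2 ∧
      1 ≤ (p - q) ^ 2 + (p - q) * (r - s) + (r - s) ^ 2 := by
  refine ⟨one_le_sq_add_mul_add_sq ?_, one_le_sq_add_mul_add_sq ?_,
    one_le_sq_add_mul_add_sq ?_⟩ <;> by_contra! h
  · simp [h.1, h.2] at hdet
  · simp [h.1, h.2] at hdet
  · rw [sub_eq_zero.1 h.1, sub_eq_zero.1 h.2, mul_comm] at hdet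
    simp at hdet

theorem sum_le_of_qfRel {u v w u' v' w' : ℤ} (hpos : 0 < u ∧ 0 < v ∧ 0 < w)
    (hodd : u % 2 = 1 ∧ v % 2 = 1 ∧ w % 2 = 1) (hodd' : u' % 2 = 1 ∧ v' % 2 = 1 ∧ w' % 2 = 1)
    (h : qfRel (obtuseForm (u, v, w)) (obtuseForm (u', v', w'))) :
    u + v + w ≤ u' + v' + w' := by
  obtain ⟨p, q, r, s, hdet, h1, h2, h3⟩ := qfRel_obtuseForm_entries hodd.1 hodd.2.1 hodd.2.2
    hodd'.1 hodd'.2.1 hodd'.2.2 h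
  obtain ⟨b1, b2, b3⟩ := brackets_of_det hdet
  nlinarith [mul_le_mul_of_nonneg_left b1 hpos.1.le, mul_le_mul_of_nonneg_left b2 hpos.2.1.le,
    mul_le_mul_of_nonneg_left b3 hpos.2.2.le]

theorem abs_le_one_of_bracket {x y : ℤ} (h : x ^ 2 + x * y + y ^ 2 = 1) :
    (-1 ≤ x ∧ x ≤ 1) ∧ -1 ≤ y ∧ y ≤ 1 := by
  refine ⟨⟨?_, ?_⟩, ?_, ?_⟩
  · nlinarith [sq_nonneg (x + 2 * y)]
  · nlinarith [sq_nonneg (x + 2 * y)]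
  · nlinarith [sq_nonneg (2 * x + y)]
  · nlinarith [sq_nonneg (2 * x + y)]

theorem rotation_of_qfRel {u v w u' v' w' : ℤ} (hpos : 0 < u ∧ 0 < v ∧ 0 < w)
    (hpos' : 0 < u' ∧ 0 < v' ∧ 0 < w')
    (hodd : u % 2 = 1 ∧ v % 2 = 1 ∧ w % 2 = 1) (hodd' : u' % 2 = 1 ∧ v' % 2 = 1 ∧ w' % 2 = 1)
    (h : qfRel (obtuseForm (u, v, w)) (obtuseForm (u', v', w'))) :
    (u', v', w') = (u, v, w) ∨ (u', v', w') = (v, w, u) ∨ (u', v', w') = (w, u, v) := by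
  have hle := sum_le_of_qfRel hpos' hodd' hodd (qfRel_equivalence.symm h)
  obtain ⟨p, q, r, s, hdet, h1, h2, h3⟩ := qfRel_obtuseForm_entries hodd.1 hodd.2.1 hodd.2.2
    hodd'.1 hodd'.2.1 hodd'.2.2 h
  obtain ⟨b1, b2, b3⟩ := brackets_of_det hdet
  have c1 := mul_le_mul_of_nonneg_left b1 hpos.1.le
  have c2 := mul_le_mul_of_nonneg_left b2 hpos.2.1.le
  have c3 := mul_le_mul_of_nonneg_left b3 hpos.2.2.le
  have e1 : p ^ 2 + p * r + r ^ 2 = 1 :=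
    mul_left_cancel₀ hpos.1.ne' (by linarith)
  have e2 : q ^ 2 + q * s + s ^ 2 = 1 :=
    mul_left_cancel₀ hpos.2.1.ne' (by linarith)
  have e3 : (p - q) ^ 2 + (p - q) * (r - s) + (r - s) ^ 2 = 1 :=
    mul_left_cancel₀ hpos.2.2.ne' (by linarith)
  obtain ⟨⟨p1, p2⟩, r1, r2⟩ := abs_le_one_of_bracket e1
  obtain ⟨⟨q1, q2⟩, s1, s2⟩ := abs_le_one_of_bracket e2
  simp only [Prod.mk.injEq]
  clear hle h c1 c2 c3 b1 b2 b3
  interval_cases p <;> interval_cases r <;> try omega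
  all_goals interval_cases q <;> interval_cases s <;> omega

theorem exists_obtuseForm {n : ℤ} (hn : 0 < n) (hodd : n % 2 = 1) (N : ℕ) :
    ∀ a b c : ℤ, 0 < a → b ^ 2 - 4 * a * c = -n → (2 * a + b + 2 * c).toNat = N →
      ∃ x ∈ oddTriples n, qfRel (a, b, c) (obtuseForm x) := by
  induction N using Nat.strong_induction_on with
  | _ N ih =>
    intro a b c ha hd hN
    have hc : 0 < c := by
      refine pos_of_mul_pos_right (a := 4 * a) ?_ (by linarith)
      nlinarith [sq_nonneg b]
    have hs : 0 < a + b + c := by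
      refine pos_of_mul_pos_right (a := 4 * a) ?_ (by linarith)
      nlinarith [sq_nonneg (2 * a + b)]
    have hb : b % 2 = 1 := by
      rcases Int.emod_two_eq_zero_or_one b with h | h
      · obtain ⟨k, rfl⟩ : ∃ k, b = 2 * k := ⟨b / 2, by omega⟩
        have : n = 2 * (2 * a * c - 2 * k ^ 2) := by linarith
        omega
      · exact h
    rcases lt_or_ge 0 b with h | h
    · obtain ⟨x, hx, hr⟩ := ih _ (by omega) c (-b) a hc (by linarith) rfl
      exact ⟨x, hx, qfRel_equivalence.trans
        (qfRel_iff.2 ⟨0, 1, -1, 0, by norm_num, by ext <;> dsimp only <;> ring⟩) hr⟩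
    rcases lt_or_ge (2 * a + b) 0 with h1 | h1
    · obtain ⟨x, hx, hr⟩ := ih _ (by omega) a (2 * a + b) (a + b + c) ha (by linarith) rfl
      exact ⟨x, hx, qfRel_equivalence.trans
        (qfRel_iff.2 ⟨1, 0, 1, 1, by norm_num, by ext <;> dsimp only <;> ring⟩) hr⟩
    rcases lt_or_ge (2 * c + b) 0 with h2 | h2
    · obtain ⟨x, hx, hr⟩ := ih _ (by omega) (a + b + c) (b + 2 * c) c hs (by linarith) rfl
      exact ⟨x, hx, qfRel_equivalence.trans
        (qfRel_iff.2 ⟨1, 1, 0, 1, by norm_num, by ext <;> dsimp only <;> ring⟩) hr⟩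
    refine ⟨(2 * a + b, 2 * c + b, -b), mem_oddTriples.2
      ⟨by omega, by omega, by linarith⟩, ?_⟩
    convert qfRel_equivalence.refl (a, b, c) using 1
    ext <;> simp only [obtuseForm] <;> omega

theorem qfRel_obtuseForm_rotate {u v w : ℤ} (hodd : u % 2 = 1 ∧ v % 2 = 1 ∧ w % 2 = 1) :
    qfRel (obtuseForm (u, v, w)) (obtuseForm (v, w, u)) := by
  obtain ⟨a, ha⟩ : ∃ a, u = 2 * a - w := ⟨(u + w) / 2, by omega⟩
  obtain ⟨b, hb⟩ : ∃ b, v = 2 * b - w := ⟨(v + w) / 2, by omega⟩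
  have e1 : (u + w) / 2 = a := by omega
  have e2 : (v + w) / 2 = b := by omega
  have e3 : (v + u) / 2 = a + b - w := by omega
  have e4 : (w + u) / 2 = a := by omega
  simp only [obtuseForm, e1, e2, e3, e4]
  refine qfRel_iff.2 ⟨1, 1, -1, 0, by norm_num, ?_⟩
  ext <;> dsimp only <;> linarith

theorem qfRel_obtuseForm_diag {k : ℤ} :
    qfRel (obtuseForm (k, k, k)) (k, k, k) := by
  have e : (k + k) / 2 = k := by omega
  simp only [obtuseForm, e]
  exact qfRel_iff.2 ⟨0, 1, -1, 0, by norm_num, by ext <;> dsimp only <;> ring⟩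

open Classical in
theorem card_fiber_obtuseForm {n : ℤ} (hodd : n % 2 = 1) {x : ℤ × ℤ × ℤ}
    (hx : x ∈ oddTriples n) :
    ((oddTriples n).filter fun y =>
        Quot.mk qfRel (obtuseForm y) = Quot.mk qfRel (obtuseForm x)).card
      + 2 * (if ∃ k : ℤ, Quot.mk qfRel (k, k, k) = Quot.mk qfRel (obtuseForm x) then 1 else 0)
      = 3 := by
  obtain ⟨u, v, w⟩ := x
  obtain ⟨hpos, ho, hs⟩ := mem_oddTriples.1 hx
  have hfib : ((oddTriples n).filter fun y =>
      Quot.mk qfRel (obtuseForm y) = Quot.mk qfRel (obtuseForm (u, v, w)))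
      = {(u, v, w), (v, w, u), (w, u, v)} := by
    ext ⟨u', v', w'⟩
    simp only [Finset.mem_filter, quot_mk_qfRel_eq_iff, Finset.mem_insert, Finset.mem_singleton]
    constructor
    · rintro ⟨h1, h2⟩
      obtain ⟨hpos', ho', hs'⟩ := mem_oddTriples.1 h1
      exact rotation_of_qfRel hpos hpos' ho ho' (qfRel_equivalence.symm h2)
    · rintro (h | h | h) <;> obtain ⟨rfl, rfl, rfl⟩ := h
      · exact ⟨hx, qfRel_equivalence.refl _⟩
      · exact ⟨mem_oddTriples.2 ⟨by omega, by omega, by linarith⟩,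
          qfRel_equivalence.symm (qfRel_obtuseForm_rotate ho)⟩
      · exact ⟨mem_oddTriples.2 ⟨by omega, by omega, by linarith⟩,
          qfRel_obtuseForm_rotate ⟨ho.2.2, ho.1, ho.2.1⟩⟩
  have hspec : (∃ k : ℤ, Quot.mk qfRel (k, k, k) = Quot.mk qfRel (obtuseForm (u, v, w)))
      ↔ u = v ∧ v = w := by
    constructor
    · rintro ⟨k, hk⟩
      rw [quot_mk_qfRel_eq_iff] at hk
      have hd := discr_eq_of_qfRel hk
      rw [discr_obtuseForm ho.1 ho.2.1 ho.2.2, hs] at hd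
      dsimp only at hd
      have hk0 : 0 < k := by
        have := fst_pos_of_qfRel (qfRel_equivalence.symm hk)
        rw [discr_obtuseForm ho.1 ho.2.1 ho.2.2] at this
        refine this (by simp only [obtuseForm]; omega) ?_
        nlinarith [mul_pos hpos.1 hpos.2.1, mul_pos hpos.2.1 hpos.2.2, mul_pos hpos.2.2 hpos.1]
      have hk2 : k % 2 = 1 := by
        rcases Int.emod_two_eq_zero_or_one k with h | h
        · obtain ⟨j, rfl⟩ : ∃ j, k = 2 * j := ⟨k / 2, by omega⟩
          have : n = 2 * (6 * j ^ 2) := by linarith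
          omega
        · exact h
      have := rotation_of_qfRel ⟨hk0, hk0, hk0⟩ hpos ⟨hk2, hk2, hk2⟩ ho
        (qfRel_equivalence.trans qfRel_obtuseForm_diag hk)
      simp only [Prod.mk.injEq] at this
      omega
    · rintro ⟨rfl, rfl⟩
      exact ⟨u, (quot_mk_qfRel_eq_iff.2 qfRel_obtuseForm_diag).symm⟩
  rw [hfib]
  simp only [hspec]
  split_ifs with h
  · obtain ⟨rfl, rfl⟩ := h
    simp
  · rw [Finset.card_eq_three.2]
    refine ⟨_, _, _, ?_, ?_, ?_, rfl⟩ <;> simp only [ne_eq, Prod.mk.injEq] <;> omega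

theorem three_mul_hurwitzH {n : ℤ} (hn : 0 < n) (hmod : n % 4 = 3) :
    3 * hurwitzH n = (oddTriples n).card := by
  classical
  have hodd : n % 2 = 1 := by omega
  set C := (oddTriples n).image fun x => Quot.mk qfRel (obtuseForm x) with hC
  have hclasses : qfClasses n = C := by
    ext q
    simp only [hC, qfClasses, Set.mem_ofPred_eq, Finset.coe_image, Set.mem_image, Finset.mem_coe]
    constructor
    · rintro ⟨⟨a, b, c⟩, rfl, hd, ha⟩
      obtain ⟨x, hx, hr⟩ := exists_obtuseForm hn hodd _ a b c ha hd rfl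
      exact ⟨x, hx, (quot_mk_qfRel_eq_iff.2 hr).symm⟩
    · rintro ⟨⟨u, v, w⟩, hx, rfl⟩
      obtain ⟨hpos, ho, hs⟩ := mem_oddTriples.1 hx
      refine ⟨_, rfl, ?_, ?_⟩
      · rw [discr_obtuseForm ho.1 ho.2.1 ho.2.2, hs]
      · simp only [obtuseForm]
        omega
  have h4 : {q ∈ qfClasses n | ∃ k : ℤ, Quot.mk qfRel (k, 0, k) = q} = ∅ := by
    rw [Set.eq_empty_iff_forall_notMem]
    rintro q ⟨⟨Q, rfl, hd, -⟩, k, hk⟩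
    have := discr_eq_of_qfRel (quot_mk_qfRel_eq_iff.1 hk)
    rw [hd] at this
    dsimp only at this
    have : n = 2 * (2 * k ^ 2) := by linarith
    omega
  have h3 : {q ∈ qfClasses n | ∃ k : ℤ, Quot.mk qfRel (k, k, k) = q}
      = (C.filter fun q => ∃ k : ℤ, Quot.mk qfRel (k, k, k) = q : Finset _) := by
    rw [Finset.coe_filter, hclasses]
    rfl
  have hcard : (oddTriples n).card + 2 * (C.filter fun q => ∃ k : ℤ, Quot.mk qfRel (k, k, k) = q).card
      = 3 * C.card := by
    rw [Finset.card_eq_sum_card_image (fun x => Quot.mk qfRel (obtuseForm x)) (oddTriples n),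
      ← hC, Finset.card_filter, Finset.mul_sum, ← Finset.sum_add_distrib, mul_comm 3, ← smul_eq_mul,
      ← Finset.sum_const]
    refine Finset.sum_congr rfl fun q hq => ?_
    obtain ⟨x, hx, rfl⟩ := Finset.mem_image.1 hq
    exact card_fiber_obtuseForm hodd hx
  rw [hurwitzH, if_neg hn.ne', if_pos ⟨hn, Or.inr hmod⟩, h4, h3, hclasses, Set.ncard_coe_finset,
    Set.ncard_coe_finset, Set.ncard_empty]
  have : ((oddTriples n).card : ℝ)
      + 2 * (C.filter fun q => ∃ k : ℤ, Quot.mk qfRel (k, k, k) = q).card = 3 * C.card := by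
    exact_mod_cast hcard
  push_cast
  linarith

theorem hurwitzH_of_neg {n : ℤ} (hn : n < 0) : hurwitzH n = 0 := by
  rw [hurwitzH, if_neg hn.ne, if_neg (by omega)]

theorem three_mul_hurwitzH_of_mod {n : ℤ} (hmod : n % 4 = 3) :
    3 * hurwitzH n = (oddTriples n).card := by
  rcases lt_trichotomy n 0 with hn | rfl | hn
  · have : oddTriples n = ∅ := by
      simp [oddTriples, Finset.Icc_eq_empty (show ¬ (1 : ℤ) ≤ n by omega)]
    simp [hurwitzH_of_neg hn, this]
  · omega
  · exact three_mul_hurwitzH hn hmod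

theorem four_mul_sub_sq_neg {m : ℕ} {r : ℤ} (hr : 2 * m < |r|) :
    4 * (m : ℤ) - r ^ 2 < 0 := by
  rw [← sq_abs]
  nlinarith

theorem four_mul_sub_sq_mod (m : ℤ) {r : ℤ} (hr : r % 2 = 1) : (4 * m - r ^ 2) % 4 = 3 := by
  obtain ⟨k, rfl⟩ : ∃ k, r = 2 * k + 1 := ⟨r / 2, by omega⟩
  have : 4 * m - (2 * k + 1) ^ 2 = 4 * (m - k ^ 2 - k) - 1 := by ring
  omega

theorem three_mul_finsum_hurwitzH (m : ℕ) :
    3 * ∑ᶠ r ∈ {r : ℤ | Odd r}, hurwitzH (4 * (m : ℤ) - r ^ 2)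
      = ((2 * ∑ r ∈ (Finset.Ioo (0 : ℤ) (2 * m + 1)).filter (fun r => r % 2 = 1),
          (oddTriples (4 * m - r ^ 2)).card : ℕ) : ℝ) := by
  rw [finsum_mem_eq_sum_of_inter_support_eq (t := (Finset.Ioo (-(2 * m + 1) : ℤ) (2 * m + 1)).filter
    (fun r => r % 2 = 1))]
  swap
  · ext r
    simp only [Set.mem_inter_iff, Set.mem_ofPred_eq, Function.mem_support, Finset.coe_filter,
      Finset.mem_Ioo, Int.odd_iff]
    constructor
    · rintro ⟨h1, h2⟩
      refine ⟨⟨?_, h1⟩, h2⟩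
      by_contra h3
      refine h2 (hurwitzH_of_neg (four_mul_sub_sq_neg ?_))
      rw [lt_abs]
      omega
    · rintro ⟨⟨-, h1⟩, h2⟩
      exact ⟨h1, h2⟩
  rw [Finset.mul_sum, ← Finset.sum_filter_add_sum_filter_not _ (fun r : ℤ => 0 < r),
    Nat.two_mul, Nat.cast_add]
  congr 1
  · rw [Nat.cast_sum]
    refine Finset.sum_congr ?_ fun r hr => ?_
    · ext r
      simp only [Finset.mem_filter, Finset.mem_Ioo]
      omega
    · simp only [Finset.mem_filter] at hr
      exact three_mul_hurwitzH_of_mod (four_mul_sub_sq_mod _ hr.2)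
  · rw [Nat.cast_sum]
    refine Finset.sum_nbij' (fun r => -r) (fun r => -r) ?_ ?_ (by simp) (by simp) ?_
    · intro r
      simp only [Finset.mem_filter, Finset.mem_Ioo]
      omega
    · intro r
      simp only [Finset.mem_filter, Finset.mem_Ioo]
      omega
    · intro r hr
      simp only [Finset.mem_filter] at hr
      rw [neg_sq]
      exact three_mul_hurwitzH_of_mod (four_mul_sub_sq_mod _ hr.1.2)

theorem sigma1Q_div {m k : ℕ} (hm : 0 < m) (hk : 0 < k) :
    sigma1Q ((m : ℚ) / k) = if k ∣ m then ((∑ d ∈ (m / k).divisors, d : ℕ) : ℝ) else 0 := by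
  have hk' : (k : ℚ) ≠ 0 := by exact_mod_cast hk.ne'
  split_ifs with h
  · obtain ⟨j, rfl⟩ := h
    have hj : 0 < j := Nat.pos_of_mul_pos_left hm
    rw [Nat.cast_mul, mul_div_cancel_left₀ _ hk', Nat.mul_div_cancel_left _ hk, sigma1Q,
      if_pos (by simpa using hj)]
    simp
  · rw [sigma1Q, if_neg]
    rintro ⟨h1, -⟩
    refine h ?_
    have h2 := Rat.den_eq_one_iff _ |>.1 h1
    rw [eq_div_iff hk'] at h2
    exact Int.natCast_dvd_natCast.1 (Dvd.intro_left ((m : ℚ) / k).num (by exact_mod_cast h2))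

theorem sum_divisorsAntidiagonal_dvd {m s t : ℕ} (hm : 0 < m) (hs : 0 < s) (ht : 0 < t) :
    ∑ x ∈ m.divisorsAntidiagonal, (if s ∣ x.1 ∧ t ∣ x.2 then x.1 else 0)
      = if s * t ∣ m then s * ∑ d ∈ (m / (s * t)).divisors, d else 0 := by
  rw [← Finset.sum_filter]
  split_ifs with h
  · obtain ⟨j, rfl⟩ := h
    have hj : 0 < j := Nat.pos_of_mul_pos_left hm
    rw [Nat.mul_div_cancel_left _ (Nat.mul_pos hs ht),
      ← Nat.sum_divisorsAntidiagonal (fun x _ => x), Finset.mul_sum]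
    refine Finset.sum_nbij' (fun x => (x.1 / s, x.2 / t)) (fun x => (s * x.1, t * x.2))
      ?_ ?_ ?_ ?_ ?_
    · rintro ⟨f, h⟩ hx
      simp only [Finset.mem_filter, Nat.mem_divisorsAntidiagonal] at hx ⊢
      obtain ⟨⟨h1, -⟩, ⟨f, rfl⟩, h, rfl⟩ := hx
      rw [Nat.mul_div_cancel_left _ hs, Nat.mul_div_cancel_left _ ht]
      exact ⟨Nat.eq_of_mul_eq_mul_left (Nat.mul_pos hs ht) (by linarith), hj.ne'⟩
    · rintro ⟨f, h⟩ hx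
      simp only [Finset.mem_filter, Nat.mem_divisorsAntidiagonal] at hx ⊢
      refine ⟨⟨?_, hm.ne'⟩, Dvd.intro _ rfl, Dvd.intro _ rfl⟩
      rw [← hx.1]
      ring
    · rintro ⟨f, h⟩ hx
      simp only [Finset.mem_filter] at hx
      ext
      · exact Nat.mul_div_cancel' hx.2.1
      · exact Nat.mul_div_cancel' hx.2.2
    · rintro ⟨f, h⟩ -
      simp [Nat.mul_div_cancel_left _ hs, Nat.mul_div_cancel_left _ ht]
    · rintro ⟨f, h⟩ hx
      simp only [Finset.mem_filter] at hx
      exact (Nat.mul_div_cancel' hx.2.1).symm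
  · rw [Finset.filter_false_of_mem, Finset.sum_empty]
    rintro ⟨f, g⟩ hx ⟨h1, h2⟩
    rw [Nat.mem_divisorsAntidiagonal] at hx
    exact h (hx.1 ▸ Nat.mul_dvd_mul h1 h2)

theorem sum_divisorsAntidiagonal_opposite_parity {m : ℕ} (hm : 0 < m) :
    ((∑ x ∈ m.divisorsAntidiagonal, if (x.1 + x.2) % 2 = 1 then x.1 else 0 : ℕ) : ℝ)
      = 3 * sigma1Q ((m : ℚ) / 2) - 4 * sigma1Q ((m : ℚ) / 4) := by
  have h2 := sigma1Q_div hm two_pos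
  have h4 := sigma1Q_div hm four_pos
  have e1 := sum_divisorsAntidiagonal_dvd hm one_pos two_pos
  have e2 := sum_divisorsAntidiagonal_dvd hm two_pos one_pos
  have e3 := sum_divisorsAntidiagonal_dvd hm two_pos two_pos
  have key : ∑ x ∈ m.divisorsAntidiagonal, (if (x.1 + x.2) % 2 = 1 then x.1 else 0)
      + 2 * ∑ x ∈ m.divisorsAntidiagonal, (if 2 ∣ x.1 ∧ 2 ∣ x.2 then x.1 else 0)
      = ∑ x ∈ m.divisorsAntidiagonal, (if 1 ∣ x.1 ∧ 2 ∣ x.2 then x.1 else 0)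
      + ∑ x ∈ m.divisorsAntidiagonal, (if 2 ∣ x.1 ∧ 1 ∣ x.2 then x.1 else 0) := by
    rw [Finset.mul_sum, ← Finset.sum_add_distrib, ← Finset.sum_add_distrib]
    refine Finset.sum_congr rfl fun x _ => ?_
    split_ifs <;> omega
  rw [e1, e2, e3] at key
  norm_num at h2 h4 key
  rw [h2, h4]
  have key' := congrArg (Nat.cast (R := ℝ)) key
  push_cast at key' ⊢
  split_ifs at key' ⊢ <;> linarith

theorem sum_min_opposite_parity {m : ℕ} (hm : 0 < m) :
    {p : ℤ × ℤ | p.2 ^ 2 + p.2 - p.1 ^ 2 - p.1 = (m : ℤ)}.Finite ∧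
    ∑ᶠ p ∈ {p : ℤ × ℤ | p.2 ^ 2 + p.2 - p.1 ^ 2 - p.1 = (m : ℤ)},
        ((min |p.1 + p.2 + 1| |p.1 - p.2| : ℤ) : ℝ)
      = ((2 * ∑ x ∈ m.divisorsAntidiagonal,
          if (x.1 + x.2) % 2 = 1 then min x.1 x.2 else 0 : ℕ) : ℝ) := by
  classical
  set D := m.divisorsAntidiagonal.filter fun x => (x.1 + x.2) % 2 = 1 with hD
  set i : ℕ × ℕ → ℤ × ℤ := fun x => (((x.2 : ℤ) - 1 - x.1) / 2, ((x.1 : ℤ) + x.2 - 1) / 2) with hi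
  set j : ℕ × ℕ → ℤ × ℤ := fun x => (((x.1 : ℤ) - 1 - x.2) / 2, (-(x.1 : ℤ) - x.2 - 1) / 2) with hj
  have hset : {p : ℤ × ℤ | p.2 ^ 2 + p.2 - p.1 ^ 2 - p.1 = (m : ℤ)}
      = (D.image i ∪ D.image j : Finset (ℤ × ℤ)) := by
    ext ⟨a, b⟩
    simp only [Set.mem_ofPred_eq, Finset.coe_union, Finset.coe_image, Set.mem_union, Set.mem_image,
      Finset.mem_coe, hD, Finset.mem_filter, Nat.mem_divisorsAntidiagonal]
    constructor
    · intro h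
      have h1 : (b - a) * (a + b + 1) = m := by linarith
      rcases lt_trichotomy (b - a) 0 with h2 | h2 | h2
      · have h3 : a + b + 1 < 0 := by
          by_contra h3
          have : (0 : ℤ) < m := by exact_mod_cast hm
          nlinarith
        refine Or.inr ⟨((a - b).toNat, (-(a + b + 1)).toNat), ⟨⟨?_, hm.ne'⟩, by omega⟩, ?_⟩
        · zify
          rw [Int.toNat_of_nonneg (by omega), Int.toNat_of_nonneg (by omega)]
          linarith
        · ext <;> simp only [hj] <;> omega
      · rw [h2, zero_mul] at h1
        omega
      · have h3 : 0 < a + b + 1 := by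
          have : (0 : ℤ) < m := by exact_mod_cast hm
          exact pos_of_mul_pos_right (by rwa [h1]) h2.le
        refine Or.inl ⟨((b - a).toNat, (a + b + 1).toNat), ⟨⟨?_, hm.ne'⟩, by omega⟩, ?_⟩
        · zify
          rw [Int.toNat_of_nonneg (by omega), Int.toNat_of_nonneg (by omega)]
          linarith
        · ext <;> simp only [hi] <;> omega
    · have hfac : ∀ a b : ℤ, b ^ 2 + b - a ^ 2 - a = (b - a) * (a + b + 1) := fun a b => by ring
      rintro (⟨⟨f, h⟩, ⟨⟨h1, -⟩, h2⟩, h3⟩ | ⟨⟨f, h⟩, ⟨⟨h1, -⟩, h2⟩, h3⟩) <;>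
        simp only [hi, hj, Prod.mk.injEq] at h2 h3
      · rw [hfac, show b - a = f by omega, show a + b + 1 = h by omega]
        exact_mod_cast h1
      · rw [hfac, show b - a = -f by omega, show a + b + 1 = -h by omega, neg_mul_neg]
        exact_mod_cast h1
  rw [hset]
  refine ⟨Finset.finite_toSet _, ?_⟩
  have memD : ∀ x ∈ D, 0 < x.1 ∧ 0 < x.2 ∧ (x.1 + x.2) % 2 = 1 := by
    intro x hx
    rw [hD, Finset.mem_filter] at hx
    exact ⟨Nat.pos_of_mem_divisors (Nat.fst_mem_divisors_of_mem_antidiagonal hx.1),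
      Nat.pos_of_mem_divisors (Nat.snd_mem_divisors_of_mem_antidiagonal hx.1), hx.2⟩
  have hdisj : Disjoint (D.image i) (D.image j) := by
    rw [Finset.disjoint_left]
    intro p hp hp'
    obtain ⟨x, hx, rfl⟩ := Finset.mem_image.1 hp
    obtain ⟨y, hy, h⟩ := Finset.mem_image.1 hp'
    have := memD x hx
    have := memD y hy
    simp only [hi, hj, Prod.mk.injEq] at h
    omega
  rw [finsum_mem_coe_finset, Finset.sum_union hdisj, Finset.sum_image, Finset.sum_image,
    ← Finset.sum_filter, ← hD, two_mul, Nat.cast_add, Nat.cast_sum]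
  · congr 1
    · refine Finset.sum_congr rfl fun x hx => ?_
      have := memD x hx
      rw [show (i x).1 + (i x).2 + 1 = x.2 by simp only [hi]; omega,
        show (i x).1 - (i x).2 = -x.1 by simp only [hi]; omega, abs_neg, min_comm, Nat.abs_cast,
        Nat.abs_cast]
      push_cast
      rfl
    · refine Finset.sum_congr rfl fun x hx => ?_
      have := memD x hx
      rw [show (j x).1 + (j x).2 + 1 = -x.2 by simp only [hj]; omega,
        show (j x).1 - (j x).2 = x.1 by simp only [hj]; omega, abs_neg, min_comm, Nat.abs_cast,
        Nat.abs_cast]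
      push_cast
      rfl
  · intro x hx y hy h
    have := memD x hx
    have := memD y hy
    simp only [hj, Prod.mk.injEq] at h
    ext <;> omega
  · intro x hx y hy h
    have := memD x hx
    have := memD y hy
    simp only [hi, Prod.mk.injEq] at h
    ext <;> omega

theorem statement8 (m : ℕ) (hm : 0 < m) :
    {r : ℤ | Odd r ∧ hurwitzH (4 * (m : ℤ) - r ^ 2) ≠ 0}.Finite ∧
    {p : ℤ × ℤ | p.2 ^ 2 + p.2 - p.1 ^ 2 - p.1 = (m : ℤ)}.Finite ∧
    ∑ᶠ r ∈ {r : ℤ | Odd r}, hurwitzH (4 * (m : ℤ) - r ^ 2)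
      = 2 / 3 * sigma1Q (m : ℚ) + 2 * sigma1Q ((m : ℚ) / 2) - 8 / 3 * sigma1Q ((m : ℚ) / 4)
        - 1 / 2 * ∑ᶠ p ∈ {p : ℤ × ℤ | p.2 ^ 2 + p.2 - p.1 ^ 2 - p.1 = (m : ℤ)},
            ((min |p.1 + p.2 + 1| |p.1 - p.2| : ℤ) : ℝ) := by
  obtain ⟨hfin, hsum⟩ := sum_min_opposite_parity hm
  refine ⟨?_, hfin, ?_⟩
  · refine (Set.finite_Icc (-(2 * m : ℤ)) (2 * m)).subset ?_
    rintro r ⟨-, hr⟩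
    rw [Set.mem_Icc, ← abs_le]
    by_contra! h
    exact hr (hurwitzH_of_neg (four_mul_sub_sq_neg h))
  · have h1 := three_mul_finsum_hurwitzH m
    rw [sum_card_oddTriples hm] at h1
    have h2 := quadCount_total hm
    have h3 : ∑ x ∈ m.divisorsAntidiagonal,
        (if ((x.1 : ℤ) + x.2) % 2 = 1 then 4 * (x.1 : ℤ) - 3 * min (x.1 : ℤ) x.2
          else 2 * (x.1 : ℤ))
        = 2 * ((∑ d ∈ m.divisors, d : ℕ) : ℤ)
        + 2 * ((∑ x ∈ m.divisorsAntidiagonal, if (x.1 + x.2) % 2 = 1 then x.1 else 0 : ℕ) : ℤ)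
        - 3 * ((∑ x ∈ m.divisorsAntidiagonal,
          if (x.1 + x.2) % 2 = 1 then min x.1 x.2 else 0 : ℕ) : ℤ) := by
      rw [← Nat.sum_divisorsAntidiagonal (fun x _ => x), Nat.cast_sum, Nat.cast_sum, Nat.cast_sum,
        Finset.mul_sum, Finset.mul_sum, Finset.mul_sum, ← Finset.sum_add_distrib,
        ← Finset.sum_sub_distrib]
      refine Finset.sum_congr rfl fun x _ => ?_
      split_ifs <;> push_cast <;> omega
    have h4 := sum_divisorsAntidiagonal_opposite_parity hm
    have h5 := sigma1Q_div hm one_pos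
    simp only [Nat.cast_one, div_one, one_dvd, if_true, Nat.div_one] at h5
    rw [h3] at h2
    have h6 := congrArg (Int.cast (R := ℝ)) h2
    rw [hsum, h5]
    push_cast at h1 h4 h6 ⊢
    linarith
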